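/- arXiv:2411.11415 — 2 statements merged into one kernel-verified Lean document; each statement's English description precedes it below -/
import Mathlib

section
/- Let f ∈ C²(ℝ^d) have a unique minimizer x⋆ with ∇²f(x⋆) positive definite, satisfy the PL inequality with constant C_PL, and suppose the measures μ_t ∝ e^{-f/t} are well-defined for small t > 0. Then liminf_{t→0⁺} C_P(μ_t)/t ≥ 1/λ_min(∇²f(x⋆)). -/
open Real MeasureTheory Filter Topology
open scoped RealInnerProductSpace ENNReal

/-- The Laplacian of `f`, as the trace of the second derivative. -/
noncomputable def lap {d : ℕ} (f : EuclideanSpace ℝ (Fin d) → ℝ)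
    (x : EuclideanSpace ℝ (Fin d)) : ℝ :=
  ∑ i : Fin d, ⟪EuclideanSpace.single i (1 : ℝ),
    fderiv ℝ (gradient f) x (EuclideanSpace.single i (1 : ℝ))⟫

/-- The Poincaré constant of `μ`: the least `C` such that
`Var_μ(h) ≤ C ∫ ‖∇h‖² dμ` for all smooth compactly supported `h` (`∞` if none exists). -/
noncomputable def poincareConst {d : ℕ} (μ : Measure (EuclideanSpace ℝ (Fin d))) : ℝ≥0∞ :=
  sInf {C : ℝ≥0∞ | ∀ h : EuclideanSpace ℝ (Fin d) → ℝ, ContDiff ℝ (⊤ : ℕ∞) h → HasCompactSupport h →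
    ENNReal.ofReal ((∫ x, h x ^ 2 ∂μ) - (∫ x, h x ∂μ) ^ 2) ≤
      C * ENNReal.ofReal (∫ x, ‖gradient h x‖ ^ 2 ∂μ)}

/-- The Gibbs measure `μ_t ∝ exp (-f/t)`. -/
noncomputable def muT {d : ℕ} (f : EuclideanSpace ℝ (Fin d) → ℝ) (t : ℝ) :
    Measure (EuclideanSpace ℝ (Fin d)) :=
  volume.withDensity fun x => ENNReal.ofReal (Real.exp (-f x / t) / ∫ y, Real.exp (-f y / t))

/-- The smallest eigenvalue of the Hessian of `f` at `x`, as the infimum of the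
Rayleigh quotient over unit vectors. -/
noncomputable def lamMin {d : ℕ} (f : EuclideanSpace ℝ (Fin d) → ℝ)
    (x : EuclideanSpace ℝ (Fin d)) : ℝ :=
  sInf {r : ℝ | ∃ v : EuclideanSpace ℝ (Fin d), ‖v‖ = 1 ∧ ⟪v, fderiv ℝ (gradient f) x v⟫ = r}




lemma bl_gauss_integrable {d : ℕ} {a : ℝ} (ha : 0 < a) :
    Integrable (fun y : EuclideanSpace ℝ (Fin d) => (1 + ‖y‖) ^ 2 * Real.exp (-a * ‖y‖ ^ 2)) := by
  have h0 : ∀ b : ℝ, 0 < b → Integrable (fun y : EuclideanSpace ℝ (Fin d) => Real.exp (-b * ‖y‖ ^ 2)) := by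
    intro b hb
    have := (GaussianFourier.integrable_cexp_neg_mul_sq_norm_add (V := EuclideanSpace ℝ (Fin d))
      (b := (b : ℂ)) (by simpa using hb) 0 0).re
    refine this.congr (Eventually.of_forall fun y => ?_)
    have : (-(b : ℂ) * (‖y‖ : ℂ) ^ 2 + 0 * ((inner ℝ (0 : EuclideanSpace ℝ (Fin d)) y : ℝ) : ℂ))
        = ((-b * ‖y‖ ^ 2 : ℝ) : ℂ) := by push_cast; ring
    simp only [this]
    exact Complex.exp_ofReal_re _
  have h1 := ((h0 a ha).const_mul 2).add ((h0 (a / 2) (by positivity)).const_mul (4 / a))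
  refine h1.mono' (by fun_prop) (Eventually.of_forall fun y => ?_)
  rw [Real.norm_of_nonneg (by positivity)]
  have e1 : Real.exp (-(a / 2) * ‖y‖ ^ 2) = Real.exp (a / 2 * ‖y‖ ^ 2) * Real.exp (-a * ‖y‖ ^ 2) := by
    rw [← Real.exp_add]; congr 1; ring
  have e2 : a / 2 * ‖y‖ ^ 2 ≤ Real.exp (a / 2 * ‖y‖ ^ 2) := by
    have := Real.add_one_le_exp (a / 2 * ‖y‖ ^ 2); linarith
  have e3 : 2 * ‖y‖ ^ 2 ≤ 4 / a * Real.exp (a / 2 * ‖y‖ ^ 2) := by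
    calc 2 * ‖y‖ ^ 2 = 4 / a * (a / 2 * ‖y‖ ^ 2) := by field_simp; ring
      _ ≤ _ := by gcongr
  have e4 : (1 + ‖y‖) ^ 2 ≤ 2 + 4 / a * Real.exp (a / 2 * ‖y‖ ^ 2) := by
    nlinarith [sq_nonneg (1 - ‖y‖)]
  simp only [Pi.add_apply]
  rw [e1]
  calc _ ≤ (2 + 4 / a * Real.exp (a / 2 * ‖y‖ ^ 2)) * Real.exp (-a * ‖y‖ ^ 2) := by gcongr
    _ = _ := by ring

/-- A bounded-by-quadratic continuous function is integrable against the Gaussian weight. -/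
lemma bl_integrable_weight {d : ℕ} (H : EuclideanSpace ℝ (Fin d) →L[ℝ] EuclideanSpace ℝ (Fin d))
    {lam : ℝ} (hlam : 0 < lam) (hH : ∀ y, lam * ‖y‖ ^ 2 ≤ ⟪y, H y⟫)
    {F : EuclideanSpace ℝ (Fin d) → ℝ} (hF : Continuous F) {M : ℝ}
    (hM : ∀ y, |F y| ≤ M * (1 + ‖y‖) ^ 2) :
    Integrable (fun y => F y * Real.exp (-(⟪y, H y⟫ / 2))) := by
  refine ((bl_gauss_integrable (d := d) (a := lam / 2) (by positivity)).const_mul M).mono'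
    (by fun_prop) (Eventually.of_forall fun y => ?_)
  rw [norm_mul, Real.norm_of_nonneg (Real.exp_pos _).le, Real.norm_eq_abs]
  have h2 : Real.exp (-(⟪y, H y⟫ / 2)) ≤ Real.exp (-(lam / 2) * ‖y‖ ^ 2) := by
    apply Real.exp_le_exp.2; have := hH y; linarith
  calc _ ≤ (M * (1 + ‖y‖) ^ 2) * Real.exp (-(lam / 2) * ‖y‖ ^ 2) :=
        mul_le_mul (hM y) h2 (Real.exp_pos _).le ((abs_nonneg _).trans (hM y))
    _ = _ := by ring

lemma bl_ibp {d : ℕ} (H : EuclideanSpace ℝ (Fin d) →L[ℝ] EuclideanSpace ℝ (Fin d))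
    (hsym : ∀ x y, ⟪H x, y⟫ = ⟪x, H y⟫)
    {lam : ℝ} (hlam : 0 < lam) (hH : ∀ y, lam * ‖y‖ ^ 2 ≤ ⟪y, H y⟫)
    (v : EuclideanSpace ℝ (Fin d)) (hv : ‖v‖ = 1) (hHv : H v = lam • v) :
    lam * ∫ y, ⟪v, y⟫ ^ 2 * Real.exp (-(⟪y, H y⟫ / 2)) = ∫ y, Real.exp (-(⟪y, H y⟫ / 2)) := by
  have hiv : ∀ y, |⟪v, y⟫| ≤ ‖y‖ := fun y => by
    have := abs_real_inner_le_norm v y; rwa [hv, one_mul] at this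
  have hW : ∀ y, HasFDerivAt (fun y : EuclideanSpace ℝ (Fin d) => Real.exp (-(⟪y, H y⟫ / 2)))
      (Real.exp (-(⟪y, H y⟫ / 2)) • (-((1/2 : ℝ) • ((fderivInnerCLM ℝ (y, H y)).comp
        ((ContinuousLinearMap.id ℝ _).prod H))))) y := by
    intro y
    have h1 := ((hasFDerivAt_id (𝕜 := ℝ) y).inner ℝ H.hasFDerivAt)
    have h2 := ((h1.const_mul (1/2 : ℝ)).neg).exp
    have e1 : ∀ y : EuclideanSpace ℝ (Fin d), -(⟪y, H y⟫ / 2) = -(1 / 2 * ⟪y, H y⟫) :=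
      fun y => by ring
    simp only [e1]
    exact h2
  have hWv : ∀ y, fderiv ℝ (fun y : EuclideanSpace ℝ (Fin d) => Real.exp (-(⟪y, H y⟫ / 2))) y v
      = -lam * ⟪v, y⟫ * Real.exp (-(⟪y, H y⟫ / 2)) := by
    intro y
    rw [(hW y).fderiv]
    have : ⟪y, H v⟫ = lam * ⟪v, y⟫ := by rw [hHv, inner_smul_right, real_inner_comm]
    have h3 : ⟪v, H y⟫ = lam * ⟪v, y⟫ := by rw [← hsym, hHv, inner_smul_left]; simp
    simp [fderivInnerCLM_apply, this, h3]
    ring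
  have hLv : ∀ y, fderiv ℝ (fun y : EuclideanSpace ℝ (Fin d) => ⟪v, y⟫) y v = 1 := by
    intro y
    have : HasFDerivAt (fun y : EuclideanSpace ℝ (Fin d) => ⟪v, y⟫) (innerSL ℝ v) y :=
      (innerSL ℝ v).hasFDerivAt
    rw [this.fderiv]
    simp [hv]
  have key := integral_mul_fderiv_eq_neg_fderiv_mul_of_integrable (μ := volume) (𝕜 := ℝ)
    (f := fun y : EuclideanSpace ℝ (Fin d) => ⟪v, y⟫)
    (g := fun y : EuclideanSpace ℝ (Fin d) => Real.exp (-(⟪y, H y⟫ / 2))) (v := v) ?_ ?_ ?_ ?_ ?_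
  · simp only [hLv, hWv, one_mul] at key
    rw [← integral_const_mul]
    have : (∫ y, Real.exp (-(⟪y, H y⟫ / 2))) = - ∫ y, ⟪v, y⟫ * (-lam * ⟪v, y⟫ * Real.exp (-(⟪y, H y⟫ / 2))) := by
      rw [key, neg_neg]
    rw [this, ← integral_neg]
    congr 1; ext y; ring
  · simp only [hLv]
    refine bl_integrable_weight H hlam hH (F := fun _ => 1) (by fun_prop) (M := 1) fun y => ?_
    have := norm_nonneg y
    rw [abs_one]; nlinarith
  · simp only [hWv]
    have := bl_integrable_weight H hlam hH (F := fun y => -lam * ⟪v, y⟫ ^ 2) (by fun_prop) (M := lam) fun y => ?_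
    · refine this.congr (Eventually.of_forall fun y => ?_)
      simp only; ring
    · have h0 := norm_nonneg y
      rw [abs_mul, abs_neg, abs_of_pos hlam, abs_pow]
      gcongr
      have := hiv y; linarith
  · refine bl_integrable_weight H hlam hH (F := fun y => ⟪v, y⟫) (by fun_prop) (M := 1) fun y => ?_
    have := norm_nonneg y
    have := hiv y
    nlinarith
  · intro x _; exact (innerSL ℝ v).differentiableAt
  · intro x _; exact (hW x).differentiableAt


lemma bl_gradient_phi {d : ℕ} (v : EuclideanSpace ℝ (Fin d))
    (χ : EuclideanSpace ℝ (Fin d) → ℝ) (hχ : ContDiff ℝ (⊤ : ℕ∞) χ) (r : ℝ)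
    (y : EuclideanSpace ℝ (Fin d)) :
    gradient (fun y => ⟪v, y⟫ * χ (r • y)) y
      = χ (r • y) • v + (⟪v, y⟫ * r) • gradient χ (r • y) := by
  apply HasGradientAt.gradient
  rw [hasGradientAt_iff_hasFDerivAt]
  have h1 : HasFDerivAt (fun y : EuclideanSpace ℝ (Fin d) => ⟪v, y⟫) (innerSL ℝ v) y :=
    (innerSL ℝ v).hasFDerivAt
  have h2 : HasFDerivAt (fun y : EuclideanSpace ℝ (Fin d) => r • y)
      (r • ContinuousLinearMap.id ℝ _) y := (hasFDerivAt_id y).const_smul r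
  have h3 : HasFDerivAt χ (fderiv ℝ χ (r • y)) (r • y) :=
    (hχ.differentiable (by simp) _).hasFDerivAt
  have h4 := h1.mul (h3.comp y h2)
  refine h4.congr_fderiv ?_
  ext z
  simp
  ring

lemma bl_exists_phi {d : ℕ} (H : EuclideanSpace ℝ (Fin d) →L[ℝ] EuclideanSpace ℝ (Fin d))
    (hsym : ∀ x y, ⟪H x, y⟫ = ⟪x, H y⟫)
    {lam : ℝ} (hlam : 0 < lam) (hH : ∀ y, lam * ‖y‖ ^ 2 ≤ ⟪y, H y⟫)
    (v : EuclideanSpace ℝ (Fin d)) (hv : ‖v‖ = 1) (hHv : H v = lam • v)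
    (c : ℝ) (hc : c < 1 / lam) :
    ∃ φ : EuclideanSpace ℝ (Fin d) → ℝ, ContDiff ℝ (⊤ : ℕ∞) φ ∧ HasCompactSupport φ ∧
      (∫ y, φ y * Real.exp (-(⟪y, H y⟫ / 2))) = 0 ∧
      c * (∫ y, ‖gradient φ y‖ ^ 2 * Real.exp (-(⟪y, H y⟫ / 2))) <
        ∫ y, φ y ^ 2 * Real.exp (-(⟪y, H y⟫ / 2)) := by
  have hiv : ∀ y, |⟪v, y⟫| ≤ ‖y‖ := fun y => by
    have := abs_real_inner_le_norm v y; rwa [hv, one_mul] at this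
  let b : ContDiffBump (0 : EuclideanSpace ℝ (Fin d)) := ⟨1, 2, by norm_num, by norm_num⟩
  have hbC : ContDiff ℝ (⊤ : ℕ∞) b := b.contDiff
  have hgc : Continuous (gradient (b : EuclideanSpace ℝ (Fin d) → ℝ)) := by
    have : Continuous (fderiv ℝ b) := hbC.continuous_fderiv (by simp)
    exact (InnerProductSpace.toDual ℝ _).symm.continuous.comp this
  obtain ⟨M, hM⟩ : ∃ M, ∀ y, ‖gradient (b : EuclideanSpace ℝ (Fin d) → ℝ) y‖ ≤ M := by
    obtain ⟨M, hM⟩ := (b.hasCompactSupport.fderiv (𝕜 := ℝ)).exists_bound_of_continuous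
      (hbC.continuous_fderiv (by simp))
    refine ⟨M, fun y => ?_⟩
    have := hM y
    rwa [← toDual_gradient, LinearIsometryEquiv.norm_map] at this
  have hM0 : 0 ≤ M := (norm_nonneg _).trans (hM 0)
  let φ : ℝ → EuclideanSpace ℝ (Fin d) → ℝ := fun r y => ⟪v, y⟫ * b (r • y)
  have hWc : Continuous (fun y : EuclideanSpace ℝ (Fin d) => Real.exp (-(⟪y, H y⟫ / 2))) := by
    fun_prop
  have hφc : ∀ r, ContDiff ℝ (⊤ : ℕ∞) (φ r) := by
    intro r
    have h1 : ContDiff ℝ (⊤ : ℕ∞) (fun y : EuclideanSpace ℝ (Fin d) => ⟪v, y⟫) :=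
      contDiff_const.inner ℝ contDiff_id
    have h2 : ContDiff ℝ (⊤ : ℕ∞) (fun y : EuclideanSpace ℝ (Fin d) => b (r • y)) :=
      hbC.comp (contDiff_const_smul r)
    exact h1.mul h2
  have hgrad : ∀ r y, gradient (φ r) y = b (r • y) • v + (⟪v, y⟫ * r) • gradient b (r • y) :=
    fun r y => bl_gradient_phi v b hbC r y
  have hb1 : ∀ y, |b y| ≤ 1 := fun y => by rw [abs_of_nonneg b.nonneg]; exact b.le_one
  -- limit of the squares
  have hA : Tendsto (fun r => ∫ y, φ r y ^ 2 * Real.exp (-(⟪y, H y⟫ / 2))) (𝓝[>] 0)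
      (𝓝 (∫ y, ⟪v, y⟫ ^ 2 * Real.exp (-(⟪y, H y⟫ / 2)))) := by
    refine tendsto_integral_filter_of_dominated_convergence
      (fun y => (1 + ‖y‖) ^ 2 * Real.exp (-(⟪y, H y⟫ / 2))) ?_ ?_ ?_ ?_
    · refine Eventually.of_forall fun r => Continuous.aestronglyMeasurable ?_
      exact ((hφc r).continuous.pow 2).mul hWc
    · refine Eventually.of_forall fun r => Eventually.of_forall fun y => ?_
      rw [norm_mul, Real.norm_of_nonneg (Real.exp_pos _).le, Real.norm_eq_abs, abs_pow]
      gcongr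
      simp only [φ, abs_mul]
      have := mul_le_mul (hiv y) (hb1 (r • y)) (abs_nonneg _) (norm_nonneg _)
      linarith
    · refine bl_integrable_weight H hlam hH (F := fun y => (1 + ‖y‖) ^ 2) (by fun_prop) (M := 1)
        fun y => ?_
      rw [abs_of_nonneg (by positivity), one_mul]
    · refine Eventually.of_forall fun y => ?_
      have hcont : Continuous (fun r : ℝ => φ r y ^ 2 * Real.exp (-(⟪y, H y⟫ / 2))) := by
        have : Continuous (fun r : ℝ => b (r • y)) := b.continuous.comp (by fun_prop)
        simp only [φ]; fun_prop
      have := (hcont.tendsto 0).mono_left (nhdsWithin_le_nhds (s := Set.Ioi 0))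
      have h1 : b (0 : EuclideanSpace ℝ (Fin d)) = 1 := b.one_of_mem_closedBall (by simp [b])
      simpa [φ, h1] using this
  have hB : Tendsto (fun r => ∫ y, ‖gradient (φ r) y‖ ^ 2 * Real.exp (-(⟪y, H y⟫ / 2))) (𝓝[>] 0)
      (𝓝 (∫ y, Real.exp (-(⟪y, H y⟫ / 2)))) := by
    refine tendsto_integral_filter_of_dominated_convergence
      (fun y => ((1 + M) * (1 + ‖y‖)) ^ 2 * Real.exp (-(⟪y, H y⟫ / 2))) ?_ ?_ ?_ ?_
    · refine Eventually.of_forall fun r => Continuous.aestronglyMeasurable ?_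
      have : Continuous (fun y => gradient (φ r) y) := by
        simp only [hgrad]
        have h1 : Continuous (fun y => b (r • y)) := b.continuous.comp (by fun_prop)
        have h2 : Continuous (fun y => gradient b (r • y)) := hgc.comp (by fun_prop)
        fun_prop
      exact (this.norm.pow 2).mul hWc
    · have hr1 : ∀ᶠ r : ℝ in 𝓝[>] 0, r ∈ Set.Ioo (0 : ℝ) 1 := Ioo_mem_nhdsGT one_pos
      filter_upwards [hr1] with r hr
      refine Eventually.of_forall fun y => ?_
      rw [norm_mul, Real.norm_of_nonneg (Real.exp_pos _).le, norm_pow, norm_norm]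
      gcongr
      rw [hgrad]
      have h1 : ‖b (r • y) • v‖ ≤ 1 := by
        rw [norm_smul, hv, mul_one]; exact hb1 _
      have h2 : ‖(⟪v, y⟫ * r) • gradient b (r • y)‖ ≤ ‖y‖ * M := by
        rw [norm_smul, norm_mul, Real.norm_eq_abs, Real.norm_of_nonneg hr.1.le]
        refine mul_le_mul ?_ (hM _) (norm_nonneg _) (norm_nonneg _)
        have := mul_le_mul (hiv y) hr.2.le hr.1.le (norm_nonneg y)
        linarith
      have := norm_add_le (b (r • y) • v) ((⟪v, y⟫ * r) • gradient b (r • y))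
      nlinarith [norm_nonneg y]
    · refine bl_integrable_weight H hlam hH (F := fun y => ((1 + M) * (1 + ‖y‖)) ^ 2) (by fun_prop)
        (M := (1 + M) ^ 2) fun y => ?_
      rw [abs_of_nonneg (by positivity), mul_pow]
    · refine Eventually.of_forall fun y => ?_
      have hcont : Continuous (fun r : ℝ => ‖gradient (φ r) y‖ ^ 2 * Real.exp (-(⟪y, H y⟫ / 2))) := by
        have h1 : Continuous (fun r : ℝ => b (r • y)) := b.continuous.comp (by fun_prop)
        have h2 : Continuous (fun r : ℝ => gradient b (r • y)) := hgc.comp (by fun_prop)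
        simp only [hgrad]; fun_prop
      have := (hcont.tendsto 0).mono_left (nhdsWithin_le_nhds (s := Set.Ioi 0))
      have h1 : b (0 : EuclideanSpace ℝ (Fin d)) = 1 := b.one_of_mem_closedBall (by simp [b])
      simpa [hgrad, h1, hv] using this
  have hibp := bl_ibp H hsym hlam hH v hv hHv
  have hWpos : 0 < ∫ y, Real.exp (-(⟪y, H y⟫ / 2)) := by
    have hi : Integrable (fun y => Real.exp (-(⟪y, H y⟫ / 2))) := by
      simpa using bl_integrable_weight H hlam hH (F := fun _ => 1) (by fun_prop) (M := 1) (fun y => by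
        have := norm_nonneg y
        rw [abs_one]; nlinarith)
    exact integral_exp_pos hi
  have hlim : Tendsto (fun r => (∫ y, φ r y ^ 2 * Real.exp (-(⟪y, H y⟫ / 2))) -
      c * ∫ y, ‖gradient (φ r) y‖ ^ 2 * Real.exp (-(⟪y, H y⟫ / 2))) (𝓝[>] 0)
      (𝓝 ((∫ y, ⟪v, y⟫ ^ 2 * Real.exp (-(⟪y, H y⟫ / 2))) -
        c * (∫ y, Real.exp (-(⟪y, H y⟫ / 2))))) := hA.sub (hB.const_mul c)
  have hpos : 0 < (∫ y, ⟪v, y⟫ ^ 2 * Real.exp (-(⟪y, H y⟫ / 2))) -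
        c * (∫ y, Real.exp (-(⟪y, H y⟫ / 2))) := by
    have h1 : (∫ y, ⟪v, y⟫ ^ 2 * Real.exp (-(⟪y, H y⟫ / 2)))
        = 1 / lam * ∫ y, Real.exp (-(⟪y, H y⟫ / 2)) := by
      rw [← hibp]; field_simp
    rw [h1, ← sub_mul]
    exact mul_pos (by linarith) hWpos
  obtain ⟨r, hr, hr0⟩ := ((hlim.eventually (lt_mem_nhds hpos)).and self_mem_nhdsWithin).exists
  have hr0 : (0 : ℝ) < r := hr0
  refine ⟨φ r, hφc r, ?_, ?_, by linarith⟩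
  · have : HasCompactSupport (fun y => b (r • y)) :=
      b.hasCompactSupport.comp_homeomorph (Homeomorph.smulOfNeZero r hr0.ne')
    exact this.mul_left
  · have h1 := integral_neg_eq_self (μ := (volume : Measure (EuclideanSpace ℝ (Fin d))))
      (fun y => φ r y * Real.exp (-(⟪y, H y⟫ / 2)))
    have h2 : ∀ y, φ r (-y) * Real.exp (-(⟪-y, H (-y)⟫ / 2))
        = -(φ r y * Real.exp (-(⟪y, H y⟫ / 2))) := by
      intro y
      simp [φ, b.neg]
    simp only [h2, integral_neg] at h1
    linarith


lemma bl_taylor {d : ℕ} (f : EuclideanSpace ℝ (Fin d) → ℝ) (x : EuclideanSpace ℝ (Fin d))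
    (hf : ContDiff ℝ 2 f) (hmin : ∀ y, f x ≤ f y) (y : EuclideanSpace ℝ (Fin d)) :
    Tendsto (fun t : ℝ => (f (x + √t • y) - f x) / t) (𝓝[>] 0)
      (𝓝 (⟪y, fderiv ℝ (gradient f) x y⟫ / 2)) := by
  have hd : Differentiable ℝ f := hf.differentiable (by norm_num)
  have hg : ContDiff ℝ 1 (gradient f) :=
    (InnerProductSpace.toDual ℝ (EuclideanSpace ℝ (Fin d))).symm.contDiff.comp
      (hf.fderiv_right (m := 1) (by norm_num))
  have hl : ∀ s : ℝ, HasDerivAt (fun s : ℝ => x + s • y) y s := by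
    intro s
    simpa using ((hasDerivAt_id s).smul_const y).const_add x
  have h1 : ∀ s : ℝ, HasDerivAt (fun s : ℝ => f (x + s • y) - f x) ⟪gradient f (x + s • y), y⟫ s := by
    intro s
    rw [inner_gradient_left]
    exact ((hd _).hasFDerivAt.comp_hasDerivAt s (hl s)).sub_const _
  have h0 : gradient f x = 0 := by
    have : fderiv ℝ f x = 0 :=
      IsLocalMin.fderiv_eq_zero (Eventually.of_forall hmin)
    simp [gradient, this]
  have h2 : HasDerivAt (fun s : ℝ => ⟪gradient f (x + s • y), y⟫)
      ⟪y, fderiv ℝ (gradient f) x y⟫ 0 := by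
    have hh : HasFDerivAt (gradient f) (fderiv ℝ (gradient f) (x + (0:ℝ) • y)) (x + (0:ℝ) • y) :=
      (hg.differentiable (by norm_num) _).hasFDerivAt
    have := (hh.comp_hasDerivAt (0 : ℝ) (hl 0)).inner ℝ (hasDerivAt_const (0:ℝ) y)
    simpa [real_inner_comm] using this
  have h3 : Tendsto (fun s : ℝ => ⟪gradient f (x + s • y), y⟫ / (2 * s)) (𝓝[>] 0)
      (𝓝 (⟪y, fderiv ℝ (gradient f) x y⟫ / 2)) := by
    have := (hasDerivAt_iff_tendsto_slope.1 h2).mono_left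
      (nhdsWithin_mono 0 (fun s (hs : (0:ℝ) < s) => hs.ne') : 𝓝[>] (0:ℝ) ≤ 𝓝[≠] 0)
    refine (this.div_const 2).congr fun s => ?_
    rw [slope_def_field, zero_smul, add_zero, h0, inner_zero_left, sub_zero, sub_zero, div_div, mul_comm s]
  have h4 : Tendsto (fun s : ℝ => (f (x + s • y) - f x) / s ^ 2) (𝓝[>] 0)
      (𝓝 (⟪y, fderiv ℝ (gradient f) x y⟫ / 2)) := by
    refine HasDerivAt.lhopital_zero_nhdsGT (f' := fun s => ⟪gradient f (x + s • y), y⟫)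
      (g' := fun s => 2 * s) (Eventually.of_forall h1) (Eventually.of_forall fun s => ?_) ?_ ?_ ?_ h3
    · simpa using hasDerivAt_pow 2 s
    · filter_upwards [self_mem_nhdsWithin] with s hs
      have : (0:ℝ) < s := hs
      positivity
    · have := (h1 0).continuousAt.tendsto.mono_left (nhdsWithin_le_nhds (s := Set.Ioi (0:ℝ)))
      simpa using this
    · have : Tendsto (fun s : ℝ => s ^ 2) (𝓝 0) (𝓝 (0 ^ 2)) := (continuous_pow 2).tendsto 0
      simpa using this.mono_left (nhdsWithin_le_nhds (s := Set.Ioi (0:ℝ)))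
  have hs : Tendsto (fun t : ℝ => √t) (𝓝[>] 0) (𝓝[>] 0) := by
    refine tendsto_nhdsWithin_iff.2 ⟨?_, ?_⟩
    · have := Real.continuous_sqrt.tendsto 0
      rw [Real.sqrt_zero] at this
      exact this.mono_left nhdsWithin_le_nhds
    · filter_upwards [self_mem_nhdsWithin] with t ht
      exact Real.sqrt_pos.2 ht
  refine (h4.comp hs).congr' ?_
  filter_upwards [self_mem_nhdsWithin] with t ht
  have ht : (0:ℝ) < t := ht
  simp [Real.sq_sqrt ht.le]

/-- Convergence of unnormalised rescaled integrals of compactly supported functions. -/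
lemma bl_tendsto_int {d : ℕ} (f : EuclideanSpace ℝ (Fin d) → ℝ) (x : EuclideanSpace ℝ (Fin d))
    (hf : ContDiff ℝ 2 f) (hmin : ∀ y, f x ≤ f y) (g : EuclideanSpace ℝ (Fin d) → ℝ)
    (hg : Integrable g) :
    Tendsto (fun t : ℝ => ∫ y, g y * Real.exp (-((f (x + √t • y) - f x) / t))) (𝓝[>] 0)
      (𝓝 (∫ y, g y * Real.exp (-(⟪y, fderiv ℝ (gradient f) x y⟫ / 2)))) := by
  have hfc := hf.continuous
  refine tendsto_integral_filter_of_dominated_convergence (fun y => ‖g y‖) ?_ ?_ hg.norm ?_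
  · refine Eventually.of_forall fun t => hg.aestronglyMeasurable.mul ?_
    exact Continuous.aestronglyMeasurable (by fun_prop)
  · filter_upwards [self_mem_nhdsWithin] with t ht
    have ht : (0:ℝ) < t := ht
    refine Eventually.of_forall fun y => ?_
    rw [norm_mul, Real.norm_of_nonneg (Real.exp_pos _).le]
    refine mul_le_of_le_one_right (norm_nonneg _) ?_
    rw [Real.exp_le_one_iff, neg_nonpos]
    exact div_nonneg (by linarith [hmin (x + √t • y)]) ht.le
  · refine Eventually.of_forall fun y => ?_
    exact ((Real.continuous_exp.tendsto _).comp (bl_taylor f x hf hmin y).neg).const_mul _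

/-- Rescaling of integrals against the Gibbs measure. -/
lemma bl_rescale {d : ℕ} (f : EuclideanSpace ℝ (Fin d) → ℝ) (x : EuclideanSpace ℝ (Fin d))
    (hf : ContDiff ℝ 2 f) {t : ℝ} (ht : 0 < t)
    (hint : Integrable (fun x => Real.exp (-f x / t))) :
    Integrable (fun y => Real.exp (-((f (x + √t • y) - f x) / t))) ∧
    ∃ K : ℝ, 0 < K ∧ K * (∫ y, Real.exp (-((f (x + √t • y) - f x) / t))) = 1 ∧
      ∀ g : EuclideanSpace ℝ (Fin d) → ℝ,
        ∫ z, g ((√t)⁻¹ • (z - x)) ∂(muT f t) =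
          K * ∫ y, g y * Real.exp (-((f (x + √t • y) - f x) / t)) := by
  have hs : 0 < √t := Real.sqrt_pos.2 ht
  have hfc := hf.continuous
  have hexp : ∀ y, Real.exp (-((f (x + √t • y) - f x) / t))
      = Real.exp (f x / t) * Real.exp (-f (x + √t • y) / t) := by
    intro y; rw [← Real.exp_add]; congr 1; ring
  have hcv : ∀ F : EuclideanSpace ℝ (Fin d) → ℝ,
      ∫ z, F z = √t ^ d * ∫ y, F (x + √t • y) := by
    intro F
    have h1 := Measure.integral_comp_smul (volume : Measure (EuclideanSpace ℝ (Fin d)))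
      (fun z => F (x + z)) (√t)
    rw [h1, integral_add_left_eq_self (fun z => F z) x]
    simp only [finrank_euclideanSpace, Fintype.card_fin, smul_eq_mul]
    rw [abs_of_pos (by positivity)]
    field_simp
  have hZ : 0 < ∫ y, Real.exp (-f y / t) := integral_exp_pos hint
  set Z := ∫ y, Real.exp (-f y / t) with hZdef
  refine ⟨?_, √t ^ d * Real.exp (-f x / t) / Z, by positivity, ?_, ?_⟩
  · simp only [hexp]
    refine Integrable.const_mul ?_ _
    exact (hint.comp_add_left x).comp_smul hs.ne'
  · simp only [hexp, integral_const_mul]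
    rw [hcv] at hZdef
    rw [div_mul_eq_mul_div, div_eq_one_iff_eq hZ.ne']
    calc _ = (Real.exp (-f x / t) * Real.exp (f x / t)) *
          (√t ^ d * ∫ y, Real.exp (-f (x + √t • y) / t)) := by ring
      _ = _ := by rw [← hZdef, ← Real.exp_add]; simp [neg_div]
  · intro g
    unfold muT
    rw [integral_withDensity_eq_integral_toReal_smul (by fun_prop) (by simp)]
    rw [hcv]
    rw [mul_div_assoc, mul_assoc]
    congr 1
    rw [← integral_const_mul]
    refine integral_congr_ae (Eventually.of_forall fun y => ?_)
    simp only
    rw [ENNReal.toReal_ofReal (by positivity), ← hZdef, hexp]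
    have h1 : (√t)⁻¹ • (x + √t • y - x) = y := by
      rw [add_sub_cancel_left, smul_smul, inv_mul_cancel₀ hs.ne', one_smul]
    have h2 : Real.exp (-f x / t) * Real.exp (f x / t) = 1 := by
      rw [← Real.exp_add]; simp [neg_div]
    rw [h1, smul_eq_mul]
    calc _ = (Real.exp (-f x / t) * Real.exp (f x / t)) * (Real.exp (-f (x + √t • y) / t) / Z * g y) := by
          rw [h2, one_mul]
      _ = _ := by ring

/-- The lower bound at a fixed temperature, in terms of rescaled unnormalised integrals. -/
lemma bl_fixed {d : ℕ} (f : EuclideanSpace ℝ (Fin d) → ℝ) (x : EuclideanSpace ℝ (Fin d))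
    (hf : ContDiff ℝ 2 f) (t : ℝ) (ht : 0 < t)
    (hint : Integrable (fun x => Real.exp (-f x / t)))
    (φ : EuclideanSpace ℝ (Fin d) → ℝ) (hφ : ContDiff ℝ (⊤ : ℕ∞) φ) (hφs : HasCompactSupport φ)
    (c A B G zt : ℝ)
    (hA : A = ∫ y, φ y ^ 2 * Real.exp (-((f (x + √t • y) - f x) / t)))
    (hB : B = ∫ y, φ y * Real.exp (-((f (x + √t • y) - f x) / t)))
    (hGd : G = ∫ y, ‖gradient φ y‖ ^ 2 * Real.exp (-((f (x + √t • y) - f x) / t)))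
    (hztd : zt = ∫ y in Metric.ball (0 : EuclideanSpace ℝ (Fin d)) 1,
      Real.exp (-((f (x + √t • y) - f x) / t)))
    (e1 : 0 < A - B ^ 2 / zt - c * G) (e2 : 0 < zt) :
    ENNReal.ofReal (c * t) ≤ poincareConst (muT f t) := by
  have hs : 0 < √t := Real.sqrt_pos.2 ht
  obtain ⟨hwi, K, hK, hK1, hres⟩ := bl_rescale f x hf ht hint
  have hG : 0 ≤ G := by
    rw [hGd]; exact integral_nonneg fun y => by positivity
  have hzt : zt ≤ ∫ y, Real.exp (-((f (x + √t • y) - f x) / t)) :=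
    hztd ▸ setIntegral_le_integral hwi (Eventually.of_forall fun y => (Real.exp_pos _).le)
  have hKz : K ≤ 1 / zt := by
    rw [le_div_iff₀ e2]
    calc K * zt ≤ K * ∫ y, Real.exp (-((f (x + √t • y) - f x) / t)) := by gcongr
      _ = 1 := hK1
  have hmain : c * (K * G) < K * A - (K * B) ^ 2 := by
    have h5 : K * B ^ 2 ≤ B ^ 2 / zt := by
      have := mul_le_mul_of_nonneg_right hKz (sq_nonneg B)
      calc _ ≤ _ := this
        _ = _ := by ring
    have h6 : 0 < A - K * B ^ 2 - c * G := by linarith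
    nlinarith [mul_pos hK h6]
  unfold poincareConst
  refine le_sInf fun C hC => ?_
  by_contra hlt'
  push Not at hlt'
  have hCtop : C ≠ ⊤ := ne_top_of_lt hlt'
  have hCr : C.toReal < c * t := by
    rwa [ENNReal.lt_ofReal_iff_toReal_lt hCtop] at hlt'
  let h : EuclideanSpace ℝ (Fin d) → ℝ := fun z => φ ((√t)⁻¹ • (z - x))
  have hh : ContDiff ℝ (⊤ : ℕ∞) h := by
    have : ContDiff ℝ (⊤ : ℕ∞) (fun z : EuclideanSpace ℝ (Fin d) => (√t)⁻¹ • (z - x)) :=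
      (contDiff_id.sub contDiff_const).const_smul _
    exact hφ.comp this
  have hhs : HasCompactSupport h :=
    hφs.comp_homeomorph ((Homeomorph.subRight x).trans
      (Homeomorph.smulOfNeZero ((√t)⁻¹) (inv_pos.2 hs).ne'))
  have hgrad : ∀ z, ‖gradient h z‖ ^ 2 = t⁻¹ * ‖gradient φ ((√t)⁻¹ • (z - x))‖ ^ 2 := by
    intro z
    have : gradient h z = (√t)⁻¹ • gradient φ ((√t)⁻¹ • (z - x)) := by
      apply HasGradientAt.gradient
      rw [hasGradientAt_iff_hasFDerivAt]
      have h1 : HasFDerivAt (fun z : EuclideanSpace ℝ (Fin d) => (√t)⁻¹ • (z - x))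
          ((√t)⁻¹ • ContinuousLinearMap.id ℝ _) z :=
        ((hasFDerivAt_id (𝕜 := ℝ) z).sub_const x).const_smul ((√t)⁻¹)
      have h2 : HasFDerivAt φ (fderiv ℝ φ ((√t)⁻¹ • (z - x))) ((√t)⁻¹ • (z - x)) :=
        (hφ.differentiable (by simp) _).hasFDerivAt
      refine (h2.comp z h1).congr_fderiv ?_
      ext u
      simp
    rw [this, norm_smul, mul_pow, Real.norm_of_nonneg (inv_pos.2 hs).le, inv_pow, Real.sq_sqrt ht.le]
  have hC' := hC h hh hhs
  simp only [hgrad] at hC'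
  rw [integral_const_mul] at hC'
  have r1 : ∫ z, h z ^ 2 ∂(muT f t) = K * A := by
    rw [hA]; exact hres (fun y => φ y ^ 2)
  have r2 : ∫ z, h z ∂(muT f t) = K * B := by
    rw [hB]; exact hres φ
  have r3 : ∫ z, ‖gradient φ ((√t)⁻¹ • (z - x))‖ ^ 2 ∂(muT f t) = K * G := by
    rw [hGd]; exact hres (fun y => ‖gradient φ y‖ ^ 2)
  rw [r1, r2, r3, ← ENNReal.ofReal_toReal hCtop, ← ENNReal.ofReal_mul ENNReal.toReal_nonneg,
    ENNReal.ofReal_le_ofReal_iff (by positivity)] at hC'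
  have h7 : C.toReal * (t⁻¹ * (K * G)) ≤ c * t * (t⁻¹ * (K * G)) := by gcongr
  have h8 : c * t * (t⁻¹ * (K * G)) = c * (K * G) := by field_simp
  linarith

lemma bl_zpos {d : ℕ} (H : EuclideanSpace ℝ (Fin d) →L[ℝ] EuclideanSpace ℝ (Fin d)) :
    0 < ∫ y in Metric.ball (0 : EuclideanSpace ℝ (Fin d)) 1, Real.exp (-(⟪y, H y⟫ / 2)) := by
  have hc : Continuous (fun y : EuclideanSpace ℝ (Fin d) => Real.exp (-(⟪y, H y⟫ / 2))) := by
    fun_prop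
  have : NeZero ((volume : Measure (EuclideanSpace ℝ (Fin d))).restrict
      (Metric.ball (0 : EuclideanSpace ℝ (Fin d)) 1)) := by
    refine ⟨fun h => ?_⟩
    rw [Measure.restrict_eq_zero] at h
    exact (Metric.measure_ball_pos volume (0 : EuclideanSpace ℝ (Fin d)) one_pos).ne' h
  refine integral_exp_pos ?_
  exact (hc.continuousOn.integrableOn_compact
    (isCompact_closedBall (0 : EuclideanSpace ℝ (Fin d)) 1)).mono_set Metric.ball_subset_closedBall

lemma bl_integ {d : ℕ} (φ : EuclideanSpace ℝ (Fin d) → ℝ) (hφ : ContDiff ℝ (⊤ : ℕ∞) φ)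
    (hφs : HasCompactSupport φ) :
    Integrable φ ∧ Integrable (fun y => φ y ^ 2) ∧ Integrable (fun y => ‖gradient φ y‖ ^ 2) ∧
    Integrable ((Metric.ball (0 : EuclideanSpace ℝ (Fin d)) 1).indicator (fun _ => (1 : ℝ))) := by
  have hgc : Continuous (gradient φ) := by
    have : Continuous (fderiv ℝ φ) := hφ.continuous_fderiv (by simp)
    exact (InnerProductSpace.toDual ℝ _).symm.continuous.comp this
  have hgs : HasCompactSupport (gradient φ) := by
    refine (hφs.fderiv (𝕜 := ℝ)).mono fun y hy h => hy ?_
    rw [← toDual_gradient] at h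
    exact (LinearIsometryEquiv.map_eq_zero_iff _).1 h
  have i1 : Integrable φ := hφ.continuous.integrable_of_hasCompactSupport hφs
  have i2 : Integrable (fun y => φ y ^ 2) := by
    have hc : Continuous (fun y => φ y ^ 2) := hφ.continuous.pow 2
    have hs : HasCompactSupport (fun y => φ y ^ 2) :=
      hφs.mono fun y hy h => hy (by simp only [h]; norm_num)
    exact hc.integrable_of_hasCompactSupport hs
  have i3 : Integrable (fun y => ‖gradient φ y‖ ^ 2) := by
    have hc : Continuous (fun y => ‖gradient φ y‖ ^ 2) := hgc.norm.pow 2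
    have hs : HasCompactSupport (fun y => ‖gradient φ y‖ ^ 2) :=
      hgs.mono fun y hy h => hy (by simp only [h]; norm_num)
    exact hc.integrable_of_hasCompactSupport hs
  have i4 : Integrable ((Metric.ball (0 : EuclideanSpace ℝ (Fin d)) 1).indicator (fun _ => (1 : ℝ))) := by
    rw [integrable_indicator_iff measurableSet_ball]
    have : IsFiniteMeasure ((volume : Measure (EuclideanSpace ℝ (Fin d))).restrict
        (Metric.ball (0 : EuclideanSpace ℝ (Fin d)) 1)) :=
      ⟨by rw [Measure.restrict_apply_univ]; exact measure_ball_lt_top⟩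
    exact integrable_const (1 : ℝ)
  exact ⟨i1, i2, i3, i4⟩

lemma bl_hind {d : ℕ} (w : EuclideanSpace ℝ (Fin d) → ℝ) :
      (∫ y, (Metric.ball (0 : EuclideanSpace ℝ (Fin d)) 1).indicator (fun _ => (1 : ℝ)) y * w y)
      = ∫ y in Metric.ball (0 : EuclideanSpace ℝ (Fin d)) 1, w y := by
    rw [← integral_indicator measurableSet_ball]
    refine integral_congr_ae (Eventually.of_forall fun y => ?_)
    by_cases hy : y ∈ Metric.ball (0 : EuclideanSpace ℝ (Fin d)) 1 <;> simp [Set.indicator, hy]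

lemma bl_key {d : ℕ} (f : EuclideanSpace ℝ (Fin d) → ℝ) (x : EuclideanSpace ℝ (Fin d))
    (hf : ContDiff ℝ 2 f) (hmin : ∀ y, f x ≤ f y)
    (hint : ∀ t : ℝ, 0 < t → Integrable (fun x => Real.exp (-f x / t)))
    (φ : EuclideanSpace ℝ (Fin d) → ℝ) (hφ : ContDiff ℝ (⊤ : ℕ∞) φ) (hφs : HasCompactSupport φ)
    (c : ℝ)
    (h0 : (∫ y, φ y * Real.exp (-(⟪y, fderiv ℝ (gradient f) x y⟫ / 2))) = 0)
    (hlt : c * (∫ y, ‖gradient φ y‖ ^ 2 * Real.exp (-(⟪y, fderiv ℝ (gradient f) x y⟫ / 2))) <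
        ∫ y, φ y ^ 2 * Real.exp (-(⟪y, fderiv ℝ (gradient f) x y⟫ / 2))) :
    ∀ᶠ t : ℝ in 𝓝[>] 0, ENNReal.ofReal (c * t) ≤ poincareConst (muT f t) := by
  obtain ⟨i1, i2, i3, i4⟩ := bl_integ φ hφ hφs
  have t1 := bl_tendsto_int f x hf hmin _ i1
  have t2 := bl_tendsto_int f x hf hmin _ i2
  have t3 := bl_tendsto_int f x hf hmin _ i3
  have t4 := bl_tendsto_int f x hf hmin _ i4
  rw [h0] at t1
  simp only [bl_hind] at t4
  set z := ∫ y in Metric.ball (0 : EuclideanSpace ℝ (Fin d)) 1,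
    Real.exp (-(⟪y, fderiv ℝ (gradient f) x y⟫ / 2)) with hz
  have hzpos : 0 < z := bl_zpos _
  have tt := (t2.sub ((t1.pow 2).div t4 hzpos.ne')).sub (t3.const_mul c)
  rw [zero_pow two_ne_zero, zero_div, sub_zero] at tt
  have ev1 := tt.eventually (lt_mem_nhds (sub_pos.2 hlt))
  have ev2 := t4.eventually (lt_mem_nhds hzpos)
  filter_upwards [ev1, ev2, self_mem_nhdsWithin] with t e1 e2 ht
  exact bl_fixed f x hf t ht (hint t ht) φ hφ hφs c _ _ _ _ rfl rfl rfl rfl e1 e2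

lemma bl_symm {d : ℕ} (f : EuclideanSpace ℝ (Fin d) → ℝ) (x : EuclideanSpace ℝ (Fin d))
    (hf : ContDiff ℝ 2 f) (u v : EuclideanSpace ℝ (Fin d)) :
    ⟪fderiv ℝ (gradient f) x u, v⟫ = ⟪u, fderiv ℝ (gradient f) x v⟫ := by
  have hs : IsSymmSndFDerivAt ℝ f x := hf.contDiffAt.isSymmSndFDerivAt (by simp)
  have hd : DifferentiableAt ℝ (fderiv ℝ f) x :=
    (hf.fderiv_right (m := 1) (by norm_num)).differentiable (by norm_num) x
  have hg : ContDiff ℝ 1 (gradient f) :=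
    (InnerProductSpace.toDual ℝ (EuclideanSpace ℝ (Fin d))).symm.contDiff.comp
      (hf.fderiv_right (m := 1) (by norm_num))
  have h1 : HasFDerivAt (gradient f) (fderiv ℝ (gradient f) x) x :=
    (hg.differentiable (by norm_num) x).hasFDerivAt
  have h2 : ∀ a b, ⟪fderiv ℝ (gradient f) x a, b⟫ = fderiv ℝ (fderiv ℝ f) x a b := by
    intro a b
    have k1 := h1.inner ℝ (hasFDerivAt_const b x)
    have k2 := hd.hasFDerivAt.clm_apply (hasFDerivAt_const b x)
    simp only [inner_gradient_left] at k1
    have k3 := DFunLike.congr_fun (k1.unique k2) a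
    simpa [fderivInnerCLM_apply] using k3
  rw [h2, real_inner_comm, h2]
  exact hs u v

lemma bl_eig {d : ℕ} (f : EuclideanSpace ℝ (Fin d) → ℝ) (x : EuclideanSpace ℝ (Fin d))
    (hf : ContDiff ℝ 2 f) (hd : 0 < d)
    (hposdef : ∀ v : EuclideanSpace ℝ (Fin d), v ≠ 0 → 0 < ⟪v, fderiv ℝ (gradient f) x v⟫) :
    ∃ v : EuclideanSpace ℝ (Fin d), ‖v‖ = 1 ∧ 0 < lamMin f x ∧
      fderiv ℝ (gradient f) x v = lamMin f x • v ∧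
      ∀ y, lamMin f x * ‖y‖ ^ 2 ≤ ⟪y, fderiv ℝ (gradient f) x y⟫ := by
  set H := fderiv ℝ (gradient f) x with hH
  have hsa : IsSelfAdjoint H := by
    rw [ContinuousLinearMap.isSelfAdjoint_iff_isSymmetric]
    exact fun u v => bl_symm f x hf u v
  have : Nonempty (Fin d) := ⟨⟨0, hd⟩⟩
  obtain ⟨v, hvs, hv⟩ := (isCompact_sphere (0 : EuclideanSpace ℝ (Fin d)) 1).exists_isMinOn
    (NormedSpace.sphere_nonempty.2 zero_le_one)
    (f := fun y => H.reApplyInnerSelf y) H.reApplyInnerSelf_continuous.continuousOn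
  have hv1 : ‖v‖ = 1 := by simpa using hvs
  have hv0 : v ≠ 0 := by intro h; simp [h] at hv1
  have hre : ∀ y, H.reApplyInnerSelf y = ⟪y, H y⟫ := fun y => by
    rw [ContinuousLinearMap.reApplyInnerSelf_apply, real_inner_comm]; rfl
  have hlam : lamMin f x = ⟪v, H v⟫ := by
    refine IsLeast.csInf_eq ⟨⟨v, hv1, rfl⟩, ?_⟩
    rintro r ⟨u, hu, rfl⟩
    have : H.reApplyInnerSelf v ≤ H.reApplyInnerSelf u := hv (by simpa using hu)
    rwa [hre, hre] at this
  have hvec : H v = (H.rayleighQuotient v) • v := by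
    have := hsa.eq_smul_self_of_isLocalExtrOn (x₀ := v) (Or.inl (by rw [hv1]; exact hv.localize))
    simpa using this
  have hray : H.rayleighQuotient v = lamMin f x := by
    rw [ContinuousLinearMap.rayleighQuotient, hre, hv1, hlam]; simp
  refine ⟨v, hv1, by rw [hlam]; exact hposdef v hv0, by rw [← hray]; exact hvec, fun y => ?_⟩
  by_cases hy : y = 0
  · simp [hy]
  have hyn : 0 < ‖y‖ := norm_pos_iff.2 hy
  have : H.reApplyInnerSelf v ≤ H.reApplyInnerSelf (‖y‖⁻¹ • y) :=
    hv (by simp [norm_smul, hyn.ne'])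
  rw [hre, hre, ← hlam, map_smul, inner_smul_left, inner_smul_right] at this
  simp only [conj_trivial] at this
  calc _ ≤ (‖y‖⁻¹ * (‖y‖⁻¹ * ⟪y, H y⟫)) * ‖y‖ ^ 2 := by gcongr
    _ = _ := by field_simp

theorem ballistic_poincare_lower_bound {d : ℕ}
    (f : EuclideanSpace ℝ (Fin d) → ℝ) (xstar : EuclideanSpace ℝ (Fin d))
    (CPL : ℝ) (hCPL : 0 < CPL)
    (hf : ContDiff ℝ 2 f)
    (hmin : ∀ y, f xstar ≤ f y) (huniq : ∀ y, (∀ z, f y ≤ f z) → y = xstar)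
    (hPL : ∀ x, f x - f xstar ≤ CPL / 2 * ‖gradient f x‖ ^ 2)
    (hposdef : ∀ v : EuclideanSpace ℝ (Fin d), v ≠ 0 → 0 < ⟪v, fderiv ℝ (gradient f) xstar v⟫)
    (hint : ∀ t : ℝ, 0 < t → Integrable (fun x => Real.exp (-f x / t))) :
    ENNReal.ofReal (1 / lamMin f xstar) ≤
      liminf (fun t : ℝ => poincareConst (muT f t) / ENNReal.ofReal t) (𝓝[>] 0) := by
  rcases Nat.eq_zero_or_pos d with rfl | hd
  · have : lamMin f xstar = 0 := by
      unfold lamMin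
      convert Real.sInf_empty
      ext r
      simp only [Set.mem_ofPred_eq, Set.mem_empty_iff_false, iff_false]
      rintro ⟨v, hv, -⟩
      rw [Subsingleton.elim v 0, norm_zero] at hv
      exact zero_ne_one hv
    rw [this]
    simp
  obtain ⟨v, hv, hlam, hHv, hH⟩ := bl_eig f xstar hf hd hposdef
  refine le_of_forall_lt fun a ha => ?_
  obtain ⟨b, hab, hb⟩ := exists_between ha
  refine hab.trans_le ?_
  have hbtop : b ≠ ⊤ := ne_top_of_lt hb
  have hbr : b.toReal < 1 / lamMin f xstar := by
    rwa [ENNReal.lt_ofReal_iff_toReal_lt hbtop] at hb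
  obtain ⟨φ, h1, h2, h3, h4⟩ := bl_exists_phi (fderiv ℝ (gradient f) xstar)
    (bl_symm f xstar hf) hlam hH v hv hHv b.toReal hbr
  have hev := bl_key f xstar hf hmin hint φ h1 h2 b.toReal h3 h4
  refine le_liminf_of_le (by isBoundedDefault) ?_
  filter_upwards [hev, self_mem_nhdsWithin] with t ht1 ht
  have ht : (0:ℝ) < t := ht
  rw [ENNReal.le_div_iff_mul_le (Or.inl (by simpa using ht)) (Or.inl ENNReal.ofReal_ne_top)]
  rwa [ENNReal.ofReal_mul ENNReal.toReal_nonneg, ENNReal.ofReal_toReal hbtop] at ht1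
end

section
/- Let f ∈ C²(ℝ^d) have a unique minimizer x⋆ with f(x⋆) = 0, satisfy the PL inequality with constant C_PL, and suppose Δf ≤ L₀ pointwise for some constant L₀ > 0. Let μ ∝ e^{-f} be a probability measure. Then μ satisfies a defective log-Sobolev inequality: for all compactly supported smooth probability densities ν, KL(ν‖μ) ≤ (C_PL/2)·FI(ν‖μ) + C_PL·L₀ − d. -/
open Real MeasureTheory
open scoped RealInnerProductSpace

/-- KL divergence of `ν = ρ • μ` with respect to `μ`, where `ρ = dν/dμ`. -/
noncomputable def KLdiv {d : ℕ} (μ : Measure (EuclideanSpace ℝ (Fin d)))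
    (ρ : EuclideanSpace ℝ (Fin d) → ℝ) : ℝ :=
  ∫ x, ρ x * Real.log (ρ x) ∂μ

/-- Relative Fisher information of `ν = ρ • μ` with respect to `μ`. -/
noncomputable def FIdiv {d : ℕ} (μ : Measure (EuclideanSpace ℝ (Fin d)))
    (ρ : EuclideanSpace ℝ (Fin d) → ℝ) : ℝ :=
  ∫ x, ‖gradient (fun y => Real.log (ρ y)) x‖ ^ 2 * ρ x ∂μ

/-- A suitable density `ρ = dν/dμ`: smooth square root, compactly supported,
nonnegative, integrating to one against `μ`. -/
def Suitable {d : ℕ} (μ : Measure (EuclideanSpace ℝ (Fin d)))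
    (ρ : EuclideanSpace ℝ (Fin d) → ℝ) : Prop :=
  ContDiff ℝ (⊤ : ℕ∞) (fun x => Real.sqrt (ρ x)) ∧ HasCompactSupport ρ ∧
    (∀ x, 0 ≤ ρ x) ∧ (∫ x, ρ x ∂μ) = 1


lemma ratio_integrable {X : Type*} [TopologicalSpace X] [MeasurableSpace X] [BorelSpace X]
    (μ : Measure X) [IsFiniteMeasureOnCompacts μ] (p D : X → ℝ)
    (hp : Continuous p) (hD : Continuous D) (hcs : HasCompactSupport p)
    (h0 : ∀ x, 0 ≤ p x) (K : ℝ) (hK : ∀ x, D x ^ 2 ≤ K * p x) :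
    Integrable (fun x => D x ^ 2 / p x) μ := by
  have hm : AEStronglyMeasurable (fun x => D x ^ 2 / p x) μ :=
    ((hD.measurable.pow_const 2).div hp.measurable).aestronglyMeasurable
  have hi : Integrable ((tsupport p).indicator (fun _ => |K|)) μ := by
    rw [integrable_indicator_iff (isClosed_tsupport p).measurableSet]
    exact integrableOn_const hcs.isCompact.measure_lt_top.ne
  refine hi.mono' hm (Filter.Eventually.of_forall fun x => ?_)
  by_cases hx : p x = 0
  · simp only [hx, div_zero, norm_zero]
    exact Set.indicator_nonneg (fun _ _ => abs_nonneg _) _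
  · have hpos : 0 < p x := lt_of_le_of_ne (h0 x) (Ne.symm hx)
    rw [Set.indicator_of_mem (subset_tsupport p hx), Real.norm_of_nonneg (by positivity),
      div_le_iff₀ hpos]
    exact (hK x).trans (mul_le_mul_of_nonneg_right (le_abs_self K) (h0 x))

lemma exists_G (C A : ℝ) (hC : 0 < C) : ∃ (G Ginv w : ℝ → ℝ),
    (∀ t, HasDerivAt G (w t) t) ∧ (∀ t, 0 < w t) ∧ (∀ y, G (Ginv y) = y) ∧
    (∀ t, |t| ≤ A → w t = Real.exp (-(t^2) / (2*C))) ∧ StrictMono G ∧ Continuous Ginv := by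
  set w : ℝ → ℝ := fun t => max (Real.exp (-(t^2) / (2*C))) (Real.exp (-(A^2) / (2*C))) with hw
  have hwc : Continuous w := by fun_prop
  set δ := Real.exp (-(A^2) / (2*C))
  have hδ : 0 < δ := Real.exp_pos _
  have hwδ : ∀ t, δ ≤ w t := fun t => le_max_right _ _
  have hwp : ∀ t, 0 < w t := fun t => hδ.trans_le (hwδ t)
  set G : ℝ → ℝ := fun t => ∫ s in (0:ℝ)..t, w s with hG
  have hGd : ∀ t, HasDerivAt G (w t) t := fun t =>
    intervalIntegral.integral_hasDerivAt_right (hwc.intervalIntegrable _ _)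
      (hwc.stronglyMeasurableAtFilter _ _) hwc.continuousAt
  have hGc : Continuous G := continuous_iff_continuousAt.2 fun t => (hGd t).continuousAt
  have hGm : StrictMono G := strictMono_of_hasDerivAt_pos hGd hwp
  have hmono : Monotone (fun t => G t - δ * t) := by
    apply monotone_of_hasDerivAt_nonneg (f' := fun t => w t - δ)
    · intro t
      have := (hGd t).sub ((hasDerivAt_id t).const_mul δ)
      rw [mul_one] at this
      exact this
    · intro t; simpa using hwδ t
  have hG0 : G 0 = 0 := by simp [hG]
  have hsurj : Function.Surjective G := by
    apply hGc.surjective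
    · refine Filter.tendsto_atTop_mono' _ ?_ (Filter.tendsto_id.const_mul_atTop hδ)
      filter_upwards [Filter.eventually_ge_atTop 0] with t ht
      have := hmono ht
      simp [hG0] at this
      simpa using this
    · refine Filter.tendsto_atBot_mono' _ ?_ (Filter.tendsto_id.const_mul_atBot hδ)
      filter_upwards [Filter.eventually_le_atBot 0] with t ht
      have := hmono ht
      simp [hG0] at this
      simpa using this
  let e := StrictMono.orderIsoOfSurjective G hGm hsurj
  refine ⟨G, e.symm, w, hGd, hwp, fun y => ?_, ?_, hGm, e.symm.continuous⟩
  · exact e.apply_symm_apply y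
  · intro t ht
    apply max_eq_left
    apply Real.exp_le_exp.2
    have : t^2 ≤ A^2 := by rw [← sq_abs t]; exact pow_le_pow_left₀ (abs_nonneg _) ht 2
    gcongr

lemma one_dim_A (C A : ℝ) (hC : 0 < C) (hA : 0 < A) (p D : ℝ → ℝ)
    (hp : ∀ x, HasDerivAt p (D x) x) (hD : Continuous D) (hcs : HasCompactSupport p)
    (h0 : ∀ x, 0 ≤ p x) (K : ℝ) (hK : ∀ x, D x ^ 2 ≤ K * p x) (hm : 0 < ∫ x, p x) :
    ∫ x, p x * Real.log (p x) ≤ (∫ x, p x) * Real.log (∫ x, p x)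
      + C / 2 * (∫ x, D x ^ 2 / p x)
      - (1 + Real.log (∫ s in (-A)..A, Real.exp (-(s^2) / (2*C)))) * ∫ x, p x := by
  obtain ⟨G, Gi, w, hG, hw, hGi, hwA, hGm, hGic⟩ := exists_G C A hC
  set Z := ∫ s in (-A)..A, Real.exp (-(s^2) / (2*C)) with hZ
  have hZG : Z = G A - G (-A) := by
    rw [hZ]
    apply intervalIntegral.integral_eq_sub_of_hasDerivAt
    · intro t ht
      rw [Set.uIcc_of_le (by linarith)] at ht
      rw [← hwA t (abs_le.2 ht)]
      exact hG t
    · exact Continuous.intervalIntegrable (by fun_prop) _ _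
  have hZpos : 0 < Z := by rw [hZG, sub_pos]; exact hGm (by linarith)
  set m := ∫ x, p x with hmdef
  have hpc : Continuous p := continuous_iff_continuousAt.2 fun x => (hp x).continuousAt
  have hpi : Integrable p := hpc.integrable_of_hasCompactSupport hcs
  set P : ℝ → ℝ := fun x => ∫ t in Set.Iic x, p t with hP
  have hP0 : ∀ x, 0 ≤ P x := fun x => setIntegral_nonneg measurableSet_Iic fun t _ => h0 t
  have hPm : ∀ x, P x ≤ m := fun x =>
    setIntegral_le_integral hpi (Filter.Eventually.of_forall h0)
  have hPd : ∀ x, HasDerivAt P (p x) x := by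
    intro x
    have h1 : P = fun x => P 0 + ∫ t in (0:ℝ)..x, p t := by
      funext y
      have := intervalIntegral.integral_Iic_sub_Iic (a := 0) (b := y) hpi.integrableOn hpi.integrableOn
      simp only [hP]; linarith
    rw [h1]
    exact (intervalIntegral.integral_hasDerivAt_right (hpc.intervalIntegrable _ _)
      (hpc.stronglyMeasurableAtFilter _ _) hpc.continuousAt).const_add _
  set v : ℝ → ℝ := fun x => G (-A) + Z / m * P x with hv
  have hvd : ∀ x, HasDerivAt v (Z / m * p x) x := fun x => ((hPd x).const_mul _).const_add _
  have hvc : Continuous v := continuous_iff_continuousAt.2 fun x => (hvd x).continuousAt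
  set T : ℝ → ℝ := fun x => Gi (v x) with hT
  have hTA : ∀ x, |T x| ≤ A := by
    intro x
    rw [abs_le]
    constructor
    · rw [← hGm.le_iff_le, hT]
      simp only [hGi, hv]
      have := hP0 x
      have : 0 ≤ Z / m * P x := by positivity
      linarith
    · rw [← hGm.le_iff_le, hT]
      simp only [hGi, hv]
      have : Z / m * P x ≤ Z / m * m := mul_le_mul_of_nonneg_left (hPm x) (by positivity)
      rw [div_mul_cancel₀ _ hm.ne'] at this
      linarith
  have hTc : Continuous T := hGic.comp hvc
  set T' : ℝ → ℝ := fun x => (w (T x))⁻¹ * (Z / m * p x) with hT'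
  have hTd : ∀ x, HasDerivAt T (T' x) x := by
    intro x
    have h1 : HasDerivAt Gi (w (Gi (v x)))⁻¹ (v x) :=
      HasDerivAt.of_local_left_inverse hGic.continuousAt (hG _) (hw _).ne'
        (Filter.Eventually.of_forall hGi)
    exact h1.comp x (hvd x)
  have hwT : ∀ x, w (T x) = Real.exp (-((T x)^2) / (2*C)) := fun x => hwA _ (hTA x)
  have hT'c : Continuous T' := by
    have : T' = fun x => (Real.exp (-((T x)^2) / (2*C)))⁻¹ * (Z / m * p x) := by
      funext x; simp only [hT', hwT]
    rw [this]
    have h2 : Continuous fun x => Real.exp (-((T x)^2) / (2*C)) := by fun_prop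
    exact (h2.inv₀ fun x => (Real.exp_pos _).ne').mul (by fun_prop)
  have hDcs : HasCompactSupport D := by
    have : D = deriv p := by funext x; exact (hp x).deriv.symm
    rw [this]; exact hcs.deriv
  have iTD : Integrable (fun x => T x * D x) :=
    (hTc.mul hD).integrable_of_hasCompactSupport hDcs.mul_left
  have iT'p : Integrable (fun x => T' x * p x) :=
    (hT'c.mul hpc).integrable_of_hasCompactSupport hcs.mul_left
  have iTp : Integrable (fun x => T x * p x) :=
    (hTc.mul hpc).integrable_of_hasCompactSupport hcs.mul_left
  have iTTp : Integrable (fun x => (T x)^2 / (2*C) * p x) :=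
    (Continuous.mul (by fun_prop) hpc).integrable_of_hasCompactSupport hcs.mul_left
  have ibp : ∫ x, T x * D x = - ∫ x, T' x * p x :=
    integral_mul_deriv_eq_deriv_mul_of_integrable (fun x _ => hTd x) (fun x _ => hp x) iTD iT'p iTp
  have iR : Integrable (fun x => D x ^ 2 / p x) := ratio_integrable volume p D hpc hD hcs h0 K hK
  have ipl : Integrable (fun x => p x * Real.log (p x)) :=
    (Real.continuous_mul_log.comp hpc).integrable_of_hasCompactSupport
      (hcs.comp_left (g := fun y => y * Real.log y) (by simp))
  have pt1 : ∀ x, p x * Real.log (p x) ≤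
      T' x * p x + ((-1 + Real.log m - Real.log Z) * p x - (T x)^2 / (2*C) * p x) := by
    intro x
    rcases (h0 x).eq_or_lt with h | h
    · simp [← h]
    · have h3 : 0 < T' x := by
        have := hw (T x)
        simp only [hT']; positivity
      have h4 : Real.log (T' x) = (T x)^2 / (2*C) + Real.log Z - Real.log m + Real.log (p x) := by
        simp only [hT', hwT]
        rw [Real.log_mul (by positivity) (by positivity), Real.log_mul (by positivity) (by positivity),
          Real.log_inv, Real.log_exp, Real.log_div hZpos.ne' hm.ne']
        ring
      have h5 := Real.log_le_sub_one_of_pos h3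
      have h6 : Real.log (p x) ≤ T' x - 1 - (T x)^2 / (2*C) - Real.log Z + Real.log m := by linarith
      have := mul_le_mul_of_nonneg_left h6 h.le
      linarith
  have pt2 : ∀ x, -(T x * D x) ≤ (T x)^2 / (2*C) * p x + C / 2 * (D x ^ 2 / p x) := by
    intro x
    rcases (h0 x).eq_or_lt with h | h
    · have : D x = 0 := by
        have := hK x
        rw [← h, mul_zero] at this
        exact pow_eq_zero_iff (two_ne_zero) |>.1 (le_antisymm this (sq_nonneg _))
      simp [← h, this]
    · have : (T x)^2 / (2*C) * p x + C / 2 * (D x ^ 2 / p x) + T x * D x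
        = (T x * p x + C * D x)^2 / (2 * C * p x) := by
        field_simp; ring
      have h7 : 0 ≤ (T x * p x + C * D x)^2 / (2 * C * p x) := by positivity
      linarith
  have i1 := integral_mono ipl (iT'p.add ((hpi.const_mul _).sub iTTp)) pt1
  have i2 := integral_mono iTD.neg (iTTp.add (iR.const_mul (C/2))) pt2
  simp only [Pi.add_apply, Pi.sub_apply, Pi.neg_apply] at i1 i2
  rw [integral_add iT'p (by exact (hpi.const_mul _).sub iTTp), integral_sub (hpi.const_mul _) iTTp, integral_const_mul] at i1
  rw [integral_neg, integral_add iTTp (iR.const_mul _), integral_const_mul, ibp] at i2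
  rw [← hmdef] at i1
  linarith

lemma one_dim (C : ℝ) (hC : 0 < C) (p D : ℝ → ℝ)
    (hp : ∀ x, HasDerivAt p (D x) x) (hD : Continuous D) (hcs : HasCompactSupport p)
    (h0 : ∀ x, 0 ≤ p x) (K : ℝ) (hK : ∀ x, D x ^ 2 ≤ K * p x) :
    ∫ x, p x * Real.log (p x) ≤ (∫ x, p x) * Real.log (∫ x, p x)
      + C / 2 * (∫ x, D x ^ 2 / p x)
      - (1 + 1 / 2 * Real.log (2 * π * C)) * ∫ x, p x := by
  have hpc : Continuous p := continuous_iff_continuousAt.2 fun x => (hp x).continuousAt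
  have hpi : Integrable p := hpc.integrable_of_hasCompactSupport hcs
  rcases (integral_nonneg h0 : 0 ≤ ∫ x, p x).eq_or_lt with h | h
  · have hz : p = 0 := by
      have := (integral_eq_zero_iff_of_nonneg h0 hpi).1 h.symm
      exact (hpc.ae_eq_iff_eq volume continuous_zero).1 this
    simp [hz]
  · have key := fun A hA => one_dim_A C A hC hA p D hp hD hcs h0 K hK h
    have hlim : Filter.Tendsto (fun A : ℝ => ∫ s in (-A)..A, Real.exp (-(s^2) / (2*C)))
        Filter.atTop (nhds (√(2 * π * C))) := by
      have e1 : (fun s : ℝ => Real.exp (-(s^2) / (2*C))) = fun s => Real.exp (-(1/(2*C)) * s^2) := by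
        funext s; congr 1; ring
      have := integral_gaussian (1/(2*C))
      rw [show π / (1/(2*C)) = 2 * π * C by field_simp] at this
      rw [e1, ← this]
      exact intervalIntegral_tendsto_integral (integrable_exp_neg_mul_sq (by positivity))
        Filter.tendsto_neg_atTop_atBot Filter.tendsto_id
    have hs : √(2 * π * C) ≠ 0 := by positivity
    have hl2 := hlim.log hs
    rw [Real.log_sqrt (by positivity)] at hl2
    have hfin := ((hl2.const_add 1).mul_const (∫ x, p x)).const_sub
      ((∫ x, p x) * Real.log (∫ x, p x) + C / 2 * ∫ x, D x ^ 2 / p x)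
    have := ge_of_tendsto hfin (Filter.eventually_atTop.2 ⟨1, fun A hA => key A (by linarith)⟩)
    rw [show 1 / 2 * Real.log (2 * π * C) = Real.log (2 * π * C) / 2 by ring]
    exact this

structure Nice {d : ℕ} (p : (Fin d → ℝ) → ℝ) (D : Fin d → (Fin d → ℝ) → ℝ) (K : ℝ) : Prop where
  pc : Continuous p
  Dc : ∀ i, Continuous (D i)
  cs : HasCompactSupport p
  nonneg : ∀ x, 0 ≤ p x
  bd : ∀ i x, D i x ^ 2 ≤ K * p x
  der : ∀ i x, HasDerivAt (fun t => p (Function.update x i t)) (D i x) (x i)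

lemma fubini_cons {d : ℕ} (F : (Fin (d+1) → ℝ) → ℝ) (hF : Integrable F) :
    ∫ x, F x = ∫ x' : Fin d → ℝ, ∫ y : ℝ, F (Fin.cons y x') ∧
    Integrable (fun x' : Fin d → ℝ => ∫ y : ℝ, F (Fin.cons y x')) := by
  have mp := (volume_preserving_piFinSuccAbove (fun _ : Fin (d+1) => ℝ) 0).symm
  set e := MeasurableEquiv.piFinSuccAbove (fun _ : Fin (d+1) => ℝ) 0
  have he : ∀ z : ℝ × (Fin d → ℝ), F (e.symm z) = F (Fin.cons z.1 z.2) := by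
    intro z
    congr 1
    funext j
    simp [e, Fin.insertNthEquiv]
  have hi : Integrable (fun z : ℝ × (Fin d → ℝ) => F (Fin.cons z.1 z.2))
      ((volume : Measure ℝ).prod (volume : Measure (Fin d → ℝ))) := by
    have := (mp.integrable_comp_emb e.symm.measurableEmbedding (g := F)).2 hF
    refine this.congr (Filter.Eventually.of_forall fun z => he z)
  constructor
  · rw [← integral_prod_symm _ hi, ← mp.integral_comp e.symm.measurableEmbedding F]
    exact integral_congr_ae (Filter.Eventually.of_forall fun z => he z)
  · exact hi.integral_prod_right

lemma nice_D_zero {d : ℕ} {p : (Fin d → ℝ) → ℝ} {D : Fin d → (Fin d → ℝ) → ℝ} {K : ℝ}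
    (h : Nice p D K) (i : Fin d) (x : Fin d → ℝ) (hx : p x = 0) : D i x = 0 := by
  have := h.bd i x
  rw [hx, mul_zero] at this
  exact pow_eq_zero_iff (two_ne_zero) |>.1 (le_antisymm this (sq_nonneg _))

lemma cont_cons {d : ℕ} : Continuous (fun z : ℝ × (Fin d → ℝ) => (Fin.cons z.1 z.2 : Fin (d+1) → ℝ)) := by
  refine continuous_pi fun j => ?_
  refine Fin.cases ?_ (fun k => ?_) j
  · simpa using continuous_fst
  · simp only [Fin.cons_succ]; fun_prop

lemma cs_ratio_bound (K a b : ℝ) (h0 : 0 ≤ b) (h : a ^ 2 ≤ K * b) : a ^ 2 / b ≤ |K| := by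
  rcases h0.eq_or_lt with h1 | h1
  · simp [← h1]
  · rw [div_le_iff₀ h1]
    exact h.trans (mul_le_mul_of_nonneg_right (le_abs_self K) h0)

lemma marginal {d : ℕ} {p : (Fin (d+1) → ℝ) → ℝ} {D : Fin (d+1) → (Fin (d+1) → ℝ) → ℝ} {K : ℝ}
    (h : Nice p D K) : ∃ K',
    Nice (fun x' : Fin d → ℝ => ∫ y : ℝ, p (Fin.cons y x'))
      (fun i x' => ∫ y : ℝ, D i.succ (Fin.cons y x')) K' ∧
    (∀ x' : Fin d → ℝ, HasCompactSupport (fun y : ℝ => p (Fin.cons y x'))) ∧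
    ∀ (i : Fin d) (x' : Fin d → ℝ), (∫ y : ℝ, D i.succ (Fin.cons y x')) ^ 2 /
      (∫ y : ℝ, p (Fin.cons y x')) ≤ ∫ y : ℝ, D i.succ (Fin.cons y x') ^ 2 / p (Fin.cons y x') := by
  obtain ⟨R, hR⟩ := h.cs.isCompact.isBounded.subset_closedBall (0 : Fin (d+1) → ℝ)
  have hz : ∀ x, R < ‖x‖ → p x = 0 := by
    intro x hx
    by_contra hne
    have := hR (subset_tsupport p hne)
    rw [mem_closedBall_zero_iff] at this
    linarith
  have hz1 : ∀ (y : ℝ) (x' : Fin d → ℝ), y ∉ Set.Icc (-R) R → p (Fin.cons y x') = 0 := by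
    intro y x' hy
    apply hz
    have h1 : ‖(Fin.cons y x' : Fin (d+1) → ℝ) 0‖ ≤ ‖(Fin.cons y x' : Fin (d+1) → ℝ)‖ := norm_le_pi_norm _ 0
    rw [Fin.cons_zero, Real.norm_eq_abs] at h1
    rw [Set.mem_Icc, ← abs_le, not_le] at hy
    linarith
  have hz2 : ∀ (y : ℝ) (x' : Fin d → ℝ), R < ‖x'‖ → p (Fin.cons y x') = 0 := by
    intro y x' hy
    apply hz
    refine hy.trans_le ?_
    refine (pi_norm_le_iff_of_nonneg (norm_nonneg _)).2 fun j => ?_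
    have := norm_le_pi_norm (Fin.cons y x' : Fin (d+1) → ℝ) j.succ
    simpa using this
  have hpc1 : ∀ x' : Fin d → ℝ, Continuous (fun y : ℝ => p (Fin.cons y x')) := fun x' =>
    h.pc.comp (cont_cons.comp (by fun_prop : Continuous fun y : ℝ => (y, x')))
  have hDc1 : ∀ i, ∀ x' : Fin d → ℝ, Continuous (fun y : ℝ => D i (Fin.cons y x')) := fun i x' =>
    (h.Dc i).comp (cont_cons.comp (by fun_prop : Continuous fun y : ℝ => (y, x')))
  have hcs1 : ∀ x' : Fin d → ℝ, HasCompactSupport (fun y : ℝ => p (Fin.cons y x')) := fun x' =>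
    HasCompactSupport.intro isCompact_Icc (fun y hy => hz1 y x' hy)
  have hcsD : ∀ i, ∀ x' : Fin d → ℝ, HasCompactSupport (fun y : ℝ => D i (Fin.cons y x')) :=
    fun i x' => HasCompactSupport.intro isCompact_Icc
      (fun y hy => nice_D_zero h _ _ (hz1 y x' hy))
  have hip : ∀ x' : Fin d → ℝ, Integrable (fun y : ℝ => p (Fin.cons y x')) := fun x' =>
    (hpc1 x').integrable_of_hasCompactSupport (hcs1 x')
  have hiD : ∀ i, ∀ x' : Fin d → ℝ, Integrable (fun y : ℝ => D i (Fin.cons y x')) := fun i x' =>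
    (hDc1 i x').integrable_of_hasCompactSupport (hcsD i x')
  have hiR : ∀ i, ∀ x' : Fin d → ℝ, Integrable
      (fun y : ℝ => D i (Fin.cons y x') ^ 2 / p (Fin.cons y x')) := fun i x' =>
    ratio_integrable volume _ _ (hpc1 x') (hDc1 i x') (hcs1 x') (fun _ => h.nonneg _) K
      (fun _ => h.bd _ _)
  have contI : ∀ F : (Fin (d+1) → ℝ) → ℝ, Continuous F →
      (∀ (y : ℝ) (x' : Fin d → ℝ), y ∉ Set.Icc (-R) R → F (Fin.cons y x') = 0) →
      Continuous (fun x' : Fin d → ℝ => ∫ y : ℝ, F (Fin.cons y x')) := by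
    intro F hF h0
    have : (fun x' : Fin d → ℝ => ∫ y : ℝ, F (Fin.cons y x')) =
        fun x' : Fin d → ℝ => ∫ y in Set.Icc (-R) R, F (Fin.cons y x') := by
      funext x'
      exact (setIntegral_eq_integral_of_forall_compl_eq_zero fun y hy => h0 y x' hy).symm
    rw [this]
    refine continuous_parametric_integral_of_continuous
      (f := fun (x' : Fin d → ℝ) (y : ℝ) => F (Fin.cons y x')) ?_ isCompact_Icc
    exact hF.comp (cont_cons.comp continuous_swap)
  have hCS : ∀ (i : Fin d) (x' : Fin d → ℝ), (∫ y : ℝ, D i.succ (Fin.cons y x')) ^ 2 ≤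
      (∫ y : ℝ, D i.succ (Fin.cons y x') ^ 2 / p (Fin.cons y x')) *
      (∫ y : ℝ, p (Fin.cons y x')) := by
    intro i x'
    set E := ∫ y : ℝ, D i.succ (Fin.cons y x') with hE
    set r := ∫ y : ℝ, D i.succ (Fin.cons y x') ^ 2 / p (Fin.cons y x') with hr
    set q := ∫ y : ℝ, p (Fin.cons y x') with hq
    have hq' : ∀ t : ℝ, 0 ≤ q * (t * t) + (-(2 * E)) * t + r := by
      intro t
      have e : q * (t * t) + (-(2 * E)) * t + r = ∫ y : ℝ, ((p (Fin.cons y x') * (t * t) -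
          D i.succ (Fin.cons y x') * (2 * t)) + D i.succ (Fin.cons y x') ^ 2 / p (Fin.cons y x')) := by
        rw [integral_add (by exact ((hip x').mul_const _).sub ((hiD _ x').mul_const _)) (hiR _ x'),
          integral_sub ((hip x').mul_const _) ((hiD _ x').mul_const _), integral_mul_const,
          integral_mul_const]
        ring
      rw [e]
      refine integral_nonneg fun y => ?_
      show 0 ≤ p (Fin.cons y x') * (t * t) - D i.succ (Fin.cons y x') * (2 * t) +
        D i.succ (Fin.cons y x') ^ 2 / p (Fin.cons y x')
      rcases (h.nonneg (Fin.cons y x')).eq_or_lt with h1 | h1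
      · simp [← h1, nice_D_zero h i.succ _ h1.symm]
      · have : p (Fin.cons y x') * (t * t) - D i.succ (Fin.cons y x') * (2 * t) +
          D i.succ (Fin.cons y x') ^ 2 / p (Fin.cons y x') =
          (p (Fin.cons y x') * t - D i.succ (Fin.cons y x')) ^ 2 / p (Fin.cons y x') := by
          field_simp; ring
        rw [this]; positivity
    have := discrim_le_zero hq'
    rw [discrim] at this
    nlinarith
  have hrn : ∀ (i : Fin d) (x' : Fin d → ℝ),
      0 ≤ ∫ y : ℝ, D i.succ (Fin.cons y x') ^ 2 / p (Fin.cons y x') := fun i x' =>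
    integral_nonneg fun y => div_nonneg (sq_nonneg _) (h.nonneg _)
  have hqn : ∀ (x' : Fin d → ℝ), 0 ≤ ∫ y : ℝ, p (Fin.cons y x') := fun x' =>
    integral_nonneg fun y => h.nonneg _
  refine ⟨∫ y in Set.Icc (-R) R, |K|, ⟨contI p h.pc hz1, fun i => contI _ (h.Dc _)
    fun y x' hy => nice_D_zero h _ _ (hz1 y x' hy), ?_, hqn, ?_, ?_⟩, hcs1, ?_⟩
  · refine HasCompactSupport.intro (isCompact_closedBall (0 : Fin d → ℝ) R) fun x' hx' => ?_
    rw [mem_closedBall_zero_iff, not_le] at hx'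
    simp [hz2 _ x' hx']
  · intro i x'
    refine (hCS i x').trans (mul_le_mul_of_nonneg_right ?_ (hqn x'))
    rw [← setIntegral_eq_integral_of_forall_compl_eq_zero (s := Set.Icc (-R) R)
      (fun y hy => by rw [hz1 y x' hy, div_zero])]
    refine setIntegral_mono (hiR _ x').integrableOn
      (integrableOn_const isCompact_Icc.measure_lt_top.ne) fun y => ?_
    exact cs_ratio_bound K _ _ (h.nonneg _) (h.bd _ _)
  · intro i x'
    have hDcs : HasCompactSupport (D i.succ) := by
      refine h.cs.mono' ?_
      intro x hx
      apply subset_tsupport p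
      intro h0
      exact hx (nice_D_zero h _ _ h0)
    obtain ⟨M, hM⟩ := hDcs.exists_bound_of_continuous (h.Dc _)
    have := hasDerivAt_integral_of_dominated_loc_of_deriv_le (μ := (volume : Measure ℝ))
      (F := fun (t : ℝ) (y : ℝ) => p (Fin.cons y (Function.update x' i t)))
      (F' := fun (t : ℝ) (y : ℝ) => D i.succ (Fin.cons y (Function.update x' i t)))
      (x₀ := x' i) (s := Set.univ) (bound := (Set.Icc (-R) R).indicator fun _ => M)
      Filter.univ_mem (Filter.Eventually.of_forall fun t => (hip _).aestronglyMeasurable)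
      (hip _) (hiD _ _).aestronglyMeasurable
      (Filter.Eventually.of_forall fun y t _ => ?_) ?_
      (Filter.Eventually.of_forall fun y t _ => ?_)
    · have := this.2
      simpa using this
    · by_cases hy : y ∈ Set.Icc (-R) R
      · rw [Set.indicator_of_mem hy]; exact hM _
      · rw [Set.indicator_of_notMem hy, nice_D_zero h _ _ (hz1 y _ hy), norm_zero]
    · rw [integrable_indicator_iff measurableSet_Icc]
      exact integrableOn_const isCompact_Icc.measure_lt_top.ne
    · have := h.der i.succ (Fin.cons y (Function.update x' i t))
      simp only [Fin.cons_succ, Function.update_self, ← Fin.cons_update, Function.update_idem] at this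
      exact this
  · intro i x'
    exact div_le_of_le_mul₀ (hqn x') (hrn i x') (hCS i x')

theorem euclid_lsi (C : ℝ) (hC : 0 < C) : ∀ (d : ℕ) (p : (Fin d → ℝ) → ℝ)
    (D : Fin d → (Fin d → ℝ) → ℝ) (K : ℝ), Nice p D K →
    ∫ x, p x * Real.log (p x) ≤ (∫ x, p x) * Real.log (∫ x, p x)
      + C / 2 * (∑ i, ∫ x, D i x ^ 2 / p x)
      - d * (1 + 1 / 2 * Real.log (2 * π * C)) * ∫ x, p x := by
  intro d
  induction d with
  | zero =>
    intro p D K h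
    have : (volume : Measure (Fin 0 → ℝ)) = Measure.dirac default := by
      rw [volume_pi, Measure.pi_of_empty]
      congr 1
      exact Subsingleton.elim _ _
    simp [this]
  | succ d ih =>
    intro p D K h
    obtain ⟨K', hN, hcs1, hCS⟩ := marginal h
    have IH := ih _ _ _ hN
    have hip : Integrable p := h.pc.integrable_of_hasCompactSupport h.cs
    have hiR : ∀ i, Integrable (fun x => D i x ^ 2 / p x) := fun i =>
      ratio_integrable volume _ _ h.pc (h.Dc i) h.cs h.nonneg K (h.bd i)
    have ipl : Integrable (fun x => p x * Real.log (p x)) :=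
      (Real.continuous_mul_log.comp h.pc).integrable_of_hasCompactSupport
        (h.cs.comp_left (g := fun y => y * Real.log y) (by simp))
    obtain ⟨f1, f1i⟩ := fubini_cons _ hip
    obtain ⟨f2, f2i⟩ := fubini_cons _ ipl
    have f3 := fun i => fubini_cons _ (hiR i)
    have iql : Integrable (fun x' : Fin d → ℝ => (∫ y : ℝ, p (Fin.cons y x')) *
        Real.log (∫ y : ℝ, p (Fin.cons y x'))) :=
      (Real.continuous_mul_log.comp hN.pc).integrable_of_hasCompactSupport
        (hN.cs.comp_left (g := fun y => y * Real.log y) (by simp))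
    have slice : ∀ x' : Fin d → ℝ, ∫ y : ℝ, p (Fin.cons y x') * Real.log (p (Fin.cons y x')) ≤
        (∫ y : ℝ, p (Fin.cons y x')) * Real.log (∫ y : ℝ, p (Fin.cons y x'))
        + C / 2 * (∫ y : ℝ, D 0 (Fin.cons y x') ^ 2 / p (Fin.cons y x'))
        - (1 + 1 / 2 * Real.log (2 * π * C)) * ∫ y : ℝ, p (Fin.cons y x') := by
      intro x'
      refine one_dim C hC (fun y => p (Fin.cons y x')) (fun y => D 0 (Fin.cons y x')) ?_ ?_
        (hcs1 x') (fun _ => h.nonneg _) K (fun _ => h.bd _ _)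
      · intro y
        have := h.der 0 (Fin.cons y x')
        simpa using this
      · exact (h.Dc 0).comp (cont_cons.comp (by fun_prop : Continuous fun y : ℝ => (y, x')))
    have s1 := integral_mono f2i ((iql.add ((f3 0).2.const_mul (C/2))).sub
      (f1i.const_mul (1 + 1 / 2 * Real.log (2 * π * C)))) slice
    simp only [Pi.add_apply, Pi.sub_apply] at s1
    rw [integral_sub (by exact iql.add ((f3 0).2.const_mul (C/2))) (f1i.const_mul _),
      integral_add iql ((f3 0).2.const_mul (C/2)), integral_const_mul, integral_const_mul,
      ← f2, ← f1, ← (f3 0).1] at s1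
    rw [← f1] at IH
    have s2 : ∑ i : Fin d, ∫ x' : Fin d → ℝ, (∫ y : ℝ, D i.succ (Fin.cons y x')) ^ 2 /
      (∫ y : ℝ, p (Fin.cons y x')) ≤ ∑ i : Fin d, ∫ x, D i.succ x ^ 2 / p x := by
      refine Finset.sum_le_sum fun i _ => ?_
      rw [(f3 i.succ).1]
      exact integral_mono (ratio_integrable volume _ _ hN.pc (hN.Dc i) hN.cs hN.nonneg K' (hN.bd i))
        (f3 i.succ).2 (hCS i)
    have s3 := mul_le_mul_of_nonneg_left s2 (by positivity : 0 ≤ C / 2)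
    rw [Fin.sum_univ_succ]
    push_cast
    linarith

lemma quad_growth {d : ℕ} (f : EuclideanSpace ℝ (Fin d) → ℝ) (xstar : EuclideanSpace ℝ (Fin d))
    (C : ℝ) (hC : 0 < C) (hf : ContDiff ℝ 2 f) (hfstar : f xstar = 0)
    (hmin : ∀ y, f xstar ≤ f y) (huniq : ∀ y, (∀ z, f y ≤ f z) → y = xstar)
    (hPL : ∀ x, f x ≤ C / 2 * ‖gradient f x‖ ^ 2) (x : EuclideanSpace ℝ (Fin d)) :
    1 / (2 * C) * ‖x - xstar‖ ^ 2 ≤ f x := by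
  have hf0 : ∀ y, 0 ≤ f y := fun y => hfstar ▸ hmin y
  have key : ∀ b : ℝ, 0 < b → b ^ 2 * (2 * C) < 1 → b * ‖x - xstar‖ ≤ √(f x) := by
    intro b hb hbC
    have hφc : Continuous (fun y => √(f y) + b * ‖y - x‖) := by
      have := hf.continuous
      fun_prop
    have hφt : Filter.Tendsto (fun y => √(f y) + b * ‖y - x‖) (Filter.cocompact _) Filter.atTop := by
      have h1 : Filter.Tendsto (fun y : EuclideanSpace ℝ (Fin d) => b * (‖y‖ - ‖x‖))
          (Filter.cocompact _) Filter.atTop :=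
        (Filter.tendsto_atTop_add_const_right _ (-‖x‖)
          (tendsto_norm_cocompact_atTop)).const_mul_atTop hb
      refine Filter.tendsto_atTop_mono (fun y => ?_) h1
      have h2 := mul_le_mul_of_nonneg_left (norm_sub_norm_le y x) hb.le
      have h3 := Real.sqrt_nonneg (f y)
      linarith
    obtain ⟨y, hy⟩ := hφc.exists_forall_le hφt
    by_cases hys : y = xstar
    · have := hy x
      rw [hys, hfstar] at this
      simp at this
      rw [norm_sub_rev]; exact this
    · exfalso
      have hfy : 0 < f y := by
        refine lt_of_le_of_ne (hf0 y) fun h => hys (huniq y fun z => ?_)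
        rw [← h]; exact hf0 z
      set G := gradient f y with hG
      have hGd : HasGradientAt f G y := (hf.differentiable (by norm_num)).differentiableAt.hasGradientAt
      have hd : HasDerivAt (fun t : ℝ => √(f (y + t • (-G)))) (-(‖G‖ ^ 2) / (2 * √(f y))) 0 := by
        have h1 : HasDerivAt (fun t : ℝ => y + t • (-G)) (-G) 0 := by
          simpa using ((hasDerivAt_id (0:ℝ)).smul_const (-G)).const_add y
        have h2 : HasFDerivAt f (InnerProductSpace.toDual ℝ _ G) (y + (0:ℝ) • (-G)) := by
          simpa using hGd.hasFDerivAt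
        have h3 := h2.comp_hasDerivAt (0:ℝ) h1
        have h4 := h3.sqrt (by simpa using hfy.ne')
        simpa using h4
      have hs := hd.tendsto_slope_zero_right
      have hge : -(b * ‖G‖) ≤ -(‖G‖ ^ 2) / (2 * √(f y)) := by
        refine ge_of_tendsto hs ?_
        filter_upwards [self_mem_nhdsWithin] with t ht
        have ht : 0 < t := ht
        have h5 := hy (y + t • (-G))
        have h6 : ‖y + t • (-G) - x‖ ≤ ‖y - x‖ + t * ‖G‖ := by
          have : y + t • (-G) - x = (y - x) + t • (-G) := by abel
          rw [this]
          refine (norm_add_le _ _).trans ?_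
          rw [norm_smul, norm_neg, Real.norm_of_nonneg ht.le]
        have h7 := mul_le_mul_of_nonneg_left h6 hb.le
        simp only [zero_add, zero_smul, add_zero, smul_eq_mul]
        rw [inv_mul_eq_div, le_div_iff₀ ht]
        linarith
      have hsq : 0 < √(f y) := Real.sqrt_pos.2 hfy
      have hss : √(f y) ^ 2 = f y := Real.sq_sqrt hfy.le
      rw [le_div_iff₀ (by positivity)] at hge
      have hpl := hPL y
      rw [← hG] at hpl
      have hGp : 0 < ‖G‖ := by
        refine lt_of_le_of_ne (norm_nonneg _) fun h => ?_
        rw [← h] at hpl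
        simp at hpl
        linarith
      have h8 : ‖G‖ ≤ 2 * b * √(f y) := by
        by_contra hcon
        push Not at hcon
        nlinarith
      have h9 : ‖G‖ ^ 2 ≤ (2 * b * √(f y)) ^ 2 := pow_le_pow_left₀ hGp.le h8 2
      have h10 : (2 * b * √(f y)) ^ 2 = 4 * b ^ 2 * f y := by
        rw [mul_pow, hss]; ring
      rw [h10] at h9
      have h11 : 4 * b ^ 2 * f y ≤ 4 * b ^ 2 * (C / 2 * ‖G‖ ^ 2) :=
        mul_le_mul_of_nonneg_left hpl (by positivity)
      have h12 : 0 < ‖G‖ ^ 2 := by positivity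
      nlinarith
  by_contra hcon
  push Not at hcon
  set n := ‖x - xstar‖ with hn
  have hn0 : 0 < n := by
    refine lt_of_le_of_ne (norm_nonneg _) fun h => ?_
    rw [← h] at hcon
    have := hf0 x
    simp at hcon
    linarith
  set β := (f x / n ^ 2 + 1 / (2 * C)) / 2 with hβ
  have hlt : f x / n ^ 2 < 1 / (2 * C) := by rw [div_lt_iff₀ (by positivity)]; exact hcon
  have hfn : 0 ≤ f x / n ^ 2 := div_nonneg (hf0 x) (by positivity)
  have hβ0 : 0 < β := by
    have : 0 < 1 / (2 * C) := by positivity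
    rw [hβ]; linarith
  have h1 : f x / n ^ 2 < β := by rw [hβ]; linarith
  have h2 : β < 1 / (2 * C) := by rw [hβ]; linarith
  have h3 := key (√β) (Real.sqrt_pos.2 hβ0) (by
    rw [Real.sq_sqrt hβ0.le]
    rwa [lt_div_iff₀ (by positivity)] at h2)
  have h4 := pow_le_pow_left₀ (by positivity) h3 2
  rw [mul_pow, Real.sq_sqrt hβ0.le, Real.sq_sqrt (hf0 x)] at h4
  rw [div_lt_iff₀ (by positivity)] at h1
  linarith

lemma logZ_bound {d : ℕ} (f : EuclideanSpace ℝ (Fin d) → ℝ) (xstar : EuclideanSpace ℝ (Fin d))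
    (C : ℝ) (hC : 0 < C) (hZ : Integrable (fun x => Real.exp (-f x)))
    (hq : ∀ x, 1 / (2 * C) * ‖x - xstar‖ ^ 2 ≤ f x) :
    Real.log (∫ x, Real.exp (-f x)) ≤ d * (1 / 2 * Real.log (2 * π * C)) := by
  have h1 : ∫ x : EuclideanSpace ℝ (Fin d), Real.exp (-(1 / (2 * C)) * ‖x - xstar‖ ^ 2) =
      (2 * π * C) ^ ((d : ℝ) / 2) := by
    rw [integral_sub_right_eq_self (fun x : EuclideanSpace ℝ (Fin d) =>
      Real.exp (-(1 / (2 * C)) * ‖x‖ ^ 2)) xstar,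
      GaussianFourier.integral_rexp_neg_mul_sq_norm (by positivity)]
    rw [finrank_euclideanSpace_fin]
    congr 1
    field_simp
  have hp : (0:ℝ) < (2 * π * C) ^ ((d : ℝ) / 2) := by positivity
  have h2 : Integrable (fun x : EuclideanSpace ℝ (Fin d) =>
      Real.exp (-(1 / (2 * C)) * ‖x - xstar‖ ^ 2)) :=
    Integrable.of_integral_ne_zero (by rw [h1]; exact hp.ne')
  have h3 : ∫ x, Real.exp (-f x) ≤ (2 * π * C) ^ ((d : ℝ) / 2) := by
    rw [← h1]
    refine integral_mono hZ h2 fun x => Real.exp_le_exp.2 ?_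
    have := hq x
    linarith
  calc _ ≤ Real.log ((2 * π * C) ^ ((d : ℝ) / 2)) := Real.log_le_log (integral_exp_pos hZ) h3
    _ = _ := by rw [Real.log_rpow (by positivity)]; ring

lemma norm_gradient_sq {d : ℕ} (h : EuclideanSpace ℝ (Fin d) → ℝ) (x : EuclideanSpace ℝ (Fin d)) :
    ‖gradient h x‖ ^ 2 = ∑ i, (fderiv ℝ h x (EuclideanSpace.single i (1:ℝ))) ^ 2 := by
  rw [EuclideanSpace.norm_sq_eq]
  refine Finset.sum_congr rfl fun i _ => ?_
  have : gradient h x i = fderiv ℝ h x (EuclideanSpace.single i (1:ℝ)) := by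
    have h1 : ⟪gradient h x, EuclideanSpace.single i (1:ℝ)⟫ =
        fderiv ℝ h x (EuclideanSpace.single i (1:ℝ)) := by
      simp [gradient]
    have h2 : ⟪gradient h x, EuclideanSpace.single i (1:ℝ)⟫ = gradient h x i := by
      rw [EuclideanSpace.inner_single_right]; simp
    exact h2.symm.trans h1
  rw [this, Real.norm_eq_abs, sq_abs]

/-- Euclidean log-Sobolev inequality for squares of compactly supported C¹ functions. -/
lemma lsi_g {d : ℕ} (C : ℝ) (hC : 0 < C) (g : EuclideanSpace ℝ (Fin d) → ℝ)
    (hg : ContDiff ℝ 1 g) (hcs : HasCompactSupport g) (h1 : ∫ x, g x ^ 2 = 1) :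
    ∫ x, g x ^ 2 * Real.log (g x ^ 2) ≤
      C / 2 * (∑ i, ∫ x, 4 * (fderiv ℝ g x (EuclideanSpace.single i (1:ℝ))) ^ 2)
      - d * (1 + 1 / 2 * Real.log (2 * π * C)) := by
  set φ : (Fin d → ℝ) → EuclideanSpace ℝ (Fin d) := WithLp.toLp 2 with hφ
  have mp : MeasurePreserving φ := PiLp.volume_preserving_toLp (Fin d)
  have me : MeasurableEmbedding φ := (MeasurableEquiv.toLp 2 (Fin d → ℝ)).measurableEmbedding
  have hφc : Continuous φ := PiLp.continuous_toLp 2 _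
  have hdc : ∀ v, Continuous (fun x => fderiv ℝ g x v) := fun v =>
    (hg.continuous_fderiv (by norm_num)).clm_apply continuous_const
  have hgc := hg.continuous
  obtain ⟨M, hM⟩ := (hcs.fderiv (𝕜 := ℝ)).exists_bound_of_continuous
    (hg.continuous_fderiv (by norm_num))
  have hMi : ∀ i x, (fderiv ℝ g x (EuclideanSpace.single i (1:ℝ))) ^ 2 ≤ M ^ 2 := by
    intro i x
    have h2 := (fderiv ℝ g x).le_opNorm (EuclideanSpace.single i (1:ℝ))
    rw [PiLp.norm_single, norm_one, mul_one] at h2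
    rw [← sq_abs]
    exact pow_le_pow_left₀ (abs_nonneg _) (h2.trans (hM x)) 2
  have hcs2 : HasCompactSupport (fun x => g x ^ 2) :=
    hcs.comp_left (g := fun y : ℝ => y ^ 2) (by simp)
  have nice : Nice (fun x => g (φ x) ^ 2)
      (fun i x => 2 * g (φ x) * fderiv ℝ g (φ x) (EuclideanSpace.single i (1:ℝ))) (4 * M ^ 2) := by
    refine ⟨by fun_prop, fun i => ?_, ?_, fun x => sq_nonneg _, fun i x => ?_, fun i x => ?_⟩
    · exact (continuous_const.mul (hgc.comp hφc)).mul ((hdc _).comp hφc)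
    · exact hcs2.comp_homeomorph (PiLp.homeomorph 2 (fun _ : Fin d => ℝ)).symm
    · have := mul_le_mul_of_nonneg_left (hMi i (φ x)) (by positivity : 0 ≤ 4 * g (φ x) ^ 2)
      calc _ = 4 * g (φ x) ^ 2 * (fderiv ℝ g (φ x) (EuclideanSpace.single i (1:ℝ))) ^ 2 := by ring
        _ ≤ _ := this
        _ = _ := by ring
    · have e : ∀ t : ℝ, φ (Function.update x i t) =
          φ x + (t - x i) • EuclideanSpace.single i (1:ℝ) := by
        intro t
        ext j
        by_cases hj : j = i
        · subst hj; simp [hφ]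
        · simp [hφ, hj]
      have hl : HasDerivAt (fun t : ℝ => φ (Function.update x i t))
          (EuclideanSpace.single i (1:ℝ)) (x i) := by
        simp only [e]
        have := (((hasDerivAt_id (x i)).sub_const (x i)).smul_const
          (EuclideanSpace.single i (1:ℝ))).const_add (φ x)
        simpa using this
      have hgd : HasFDerivAt g (fderiv ℝ g (φ x)) (φ (Function.update x i (x i))) := by
        rw [Function.update_eq_self]
        exact (hg.differentiable (by norm_num)).differentiableAt.hasFDerivAt
      have h3 := (hgd.comp_hasDerivAt (x i) hl).pow 2
      simp only [Function.update_eq_self, Function.comp_apply] at h3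
      have h4 : 2 * g (φ x) * fderiv ℝ g (φ x) (EuclideanSpace.single i (1:ℝ)) =
          ((2:ℕ):ℝ) * g (φ x) ^ (2-1) * fderiv ℝ g (φ x) (EuclideanSpace.single i (1:ℝ)) := by
        norm_num
      show HasDerivAt (fun t => g (φ (Function.update x i t)) ^ 2)
        (2 * g (φ x) * fderiv ℝ g (φ x) (EuclideanSpace.single i (1:ℝ))) (x i)
      rw [h4]
      exact h3
  have main := euclid_lsi C hC d _ _ _ nice
  have c1 : ∫ x, g (φ x) ^ 2 = 1 := by
    rw [← h1]; exact mp.integral_comp me (fun x => g x ^ 2)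
  have c2 : ∫ x, g (φ x) ^ 2 * Real.log (g (φ x) ^ 2) = ∫ x, g x ^ 2 * Real.log (g x ^ 2) :=
    mp.integral_comp me (fun x => g x ^ 2 * Real.log (g x ^ 2))
  have c3 : ∀ i, ∫ x, (2 * g (φ x) * fderiv ℝ g (φ x) (EuclideanSpace.single i (1:ℝ))) ^ 2 /
      g (φ x) ^ 2 ≤ ∫ x, 4 * (fderiv ℝ g x (EuclideanSpace.single i (1:ℝ))) ^ 2 := by
    intro i
    rw [← mp.integral_comp me (fun x => 4 * (fderiv ℝ g x (EuclideanSpace.single i (1:ℝ))) ^ 2)]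
    refine integral_mono (ratio_integrable volume _ _ nice.pc (nice.Dc i) nice.cs nice.nonneg _
      (nice.bd i)) ?_ fun x => ?_
    · refine (mp.integrable_comp_emb me
        (g := fun x => 4 * (fderiv ℝ g x (EuclideanSpace.single i (1:ℝ))) ^ 2)).2 ?_
      refine Continuous.integrable_of_hasCompactSupport (continuous_const.mul ((hdc _).pow 2)) ?_
      exact (hcs.fderiv (𝕜 := ℝ)).comp_left
        (g := fun l : EuclideanSpace ℝ (Fin d) →L[ℝ] ℝ => 4 * (l (EuclideanSpace.single i (1:ℝ))) ^ 2)
        (by simp)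
    · show (2 * g (φ x) * fderiv ℝ g (φ x) (EuclideanSpace.single i (1:ℝ))) ^ 2 / g (φ x) ^ 2 ≤
        4 * (fderiv ℝ g (φ x) (EuclideanSpace.single i (1:ℝ))) ^ 2
      by_cases h0 : g (φ x) = 0
      · rw [h0]; simp; positivity
      · apply le_of_eq; field_simp; ring
  have c4 := mul_le_mul_of_nonneg_left (Finset.sum_le_sum fun i (_ : i ∈ Finset.univ) => c3 i)
    (by positivity : 0 ≤ C / 2)
  rw [c1, c2, Real.log_one] at main
  linarith

theorem nonasymptotic_defective_lsi {d : ℕ}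
    (f : EuclideanSpace ℝ (Fin d) → ℝ) (xstar : EuclideanSpace ℝ (Fin d))
    (CPL L₀ : ℝ) (hCPL : 0 < CPL) (hL₀ : 0 < L₀)
    (hf : ContDiff ℝ 2 f) (hfstar : f xstar = 0)
    (hmin : ∀ y, f xstar ≤ f y) (huniq : ∀ y, (∀ z, f y ≤ f z) → y = xstar)
    (hPL : ∀ x, f x ≤ CPL / 2 * ‖gradient f x‖ ^ 2)
    (hlap : ∀ x, lap f x ≤ L₀)
    (hZ : Integrable (fun x => Real.exp (-f x)))
    (μ : Measure (EuclideanSpace ℝ (Fin d)))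
    (hμ : μ = volume.withDensity fun x =>
      ENNReal.ofReal (Real.exp (-f x) / ∫ y, Real.exp (-f y)))
    (hprob : IsProbabilityMeasure μ) :
    ∀ ρ, Suitable μ ρ → KLdiv μ ρ ≤ CPL / 2 * FIdiv μ ρ + CPL * L₀ - d := by
  rintro ρ ⟨hs, hcsρ, hρ0, hρ1⟩
  have hlogZ := logZ_bound f xstar CPL hCPL hZ
    (quad_growth f xstar CPL hCPL hf hfstar hmin huniq hPL)
  have hZpos : 0 < ∫ y, Real.exp (-f y) := integral_exp_pos hZ
  set Z := ∫ y, Real.exp (-f y) with hZdef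
  have hfc := hf.continuous
  have hintegral : ∀ F : EuclideanSpace ℝ (Fin d) → ℝ,
      ∫ x, F x ∂μ = ∫ x, (Real.exp (-f x) / Z) * F x := by
    intro F
    rw [hμ, integral_withDensity_eq_integral_toReal_smul (by fun_prop)
      (Filter.Eventually.of_forall fun x => ENNReal.ofReal_lt_top)]
    refine integral_congr_ae (Filter.Eventually.of_forall fun x => ?_)
    show (ENNReal.ofReal (Real.exp (-f x) / Z)).toReal • F x = _
    rw [ENNReal.toReal_ofReal (by positivity), smul_eq_mul]
  set g : EuclideanSpace ℝ (Fin d) → ℝ := fun x => √(ρ x) * Real.exp (-f x / 2) / √Z with hg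
  have hgC : ContDiff ℝ 1 g := by
    have h1 : ContDiff ℝ 1 (fun x => √(ρ x)) := hs.of_le (by exact_mod_cast le_top)
    have h2 : ContDiff ℝ 1 f := hf.of_le (by norm_num)
    exact (h1.mul (h2.neg.div_const 2).exp).div_const _
  have hg0 : ∀ x, 0 ≤ g x := fun x => by simp only [hg]; positivity
  have hsZ : 0 < √Z := Real.sqrt_pos.2 hZpos
  have hgsq : ∀ x, g x ^ 2 = Real.exp (-f x) / Z * ρ x := by
    intro x
    simp only [hg]
    rw [div_pow, mul_pow, Real.sq_sqrt (hρ0 x), Real.sq_sqrt hZpos.le, ← Real.exp_nat_mul]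
    push_cast
    rw [show (2:ℝ) * (-f x / 2) = -f x by ring]
    ring
  have hρg : ∀ x, ρ x = Z * Real.exp (f x) * g x ^ 2 := by
    intro x
    rw [hgsq, Real.exp_neg]
    field_simp
  have hgz : ∀ x, ρ x = 0 → g x = 0 := by
    intro x hx
    have := hgsq x
    rw [hx, mul_zero] at this
    exact pow_eq_zero_iff (two_ne_zero) |>.1 this
  have hgcs : HasCompactSupport g := by
    refine hcsρ.mono' fun x hx => subset_tsupport ρ fun h => hx (hgz x h)
  have hgc := hgC.continuous
  have hgd : Differentiable ℝ g := hgC.differentiable (by norm_num)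
  have hfd : Differentiable ℝ f := hf.differentiable (by norm_num)
  have g1 : ∫ x, g x ^ 2 = 1 := by
    rw [← hρ1, hintegral]
    simp only [hgsq]
  have lsi := lsi_g CPL hCPL g hgC hgcs g1
  -- abbreviations
  set e : Fin d → EuclideanSpace ℝ (Fin d) := fun i => EuclideanSpace.single i (1:ℝ) with he
  have hdg : ∀ i, Continuous (fun x => fderiv ℝ g x (e i)) := fun i =>
    (hgC.continuous_fderiv (by norm_num)).clm_apply continuous_const
  have hdf : ∀ i, Continuous (fun x => fderiv ℝ f x (e i)) := fun i =>
    (hf.continuous_fderiv (by norm_num)).clm_apply continuous_const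
  have hdgcs : ∀ i, HasCompactSupport (fun x => fderiv ℝ g x (e i)) := fun i =>
    (hgcs.fderiv (𝕜 := ℝ)).comp_left
        (g := fun l : EuclideanSpace ℝ (Fin d) →L[ℝ] ℝ => l (e i)) (by simp)
  have hcs2 : HasCompactSupport (fun x => g x ^ 2) :=
    hgcs.comp_left (g := fun y : ℝ => y ^ 2) (by simp)
  have iA : ∀ i, Integrable (fun x => 4 * (fderiv ℝ g x (e i)) ^ 2) := fun i =>
    Continuous.integrable_of_hasCompactSupport (continuous_const.mul ((hdg i).pow 2))
      ((hdgcs i).comp_left (g := fun y : ℝ => 4 * y ^ 2) (by simp))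
  have iB : ∀ i, Integrable (fun x => fderiv ℝ f x (e i) * (2 * g x * fderiv ℝ g x (e i))) := fun i =>
    Continuous.integrable_of_hasCompactSupport
      ((hdf i).mul ((continuous_const.mul hgc).mul (hdg i))) ((hdgcs i).mul_left.mul_left)
  have iD : ∀ i, Integrable (fun x => (fderiv ℝ f x (e i)) ^ 2 * g x ^ 2) := fun i =>
    Continuous.integrable_of_hasCompactSupport
      (((hdf i).pow 2).mul (hgc.pow 2)) hcs2.mul_left
  have ig : Integrable (fun x => g x ^ 2) :=
    (hgc.pow 2).integrable_of_hasCompactSupport hcs2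
  have ifg : Integrable (fun x => f x * g x ^ 2) :=
    (hfc.mul (hgc.pow 2)).integrable_of_hasCompactSupport hcs2.mul_left
  have igl : Integrable (fun x => g x ^ 2 * Real.log (g x ^ 2)) :=
    (Real.continuous_mul_log.comp (hgc.pow 2)).integrable_of_hasCompactSupport
      (hcs2.comp_left (g := fun y : ℝ => y * Real.log y) (by simp))
  -- KL
  have hKL : KLdiv μ ρ = (∫ x, g x ^ 2 * Real.log (g x ^ 2)) + (∫ x, f x * g x ^ 2) + Real.log Z := by
    have h1 : KLdiv μ ρ = ∫ x, (g x ^ 2 * Real.log (g x ^ 2) + f x * g x ^ 2 + Real.log Z * g x ^ 2) := by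
      rw [KLdiv, hintegral]
      refine integral_congr_ae (Filter.Eventually.of_forall fun x => ?_)
      show Real.exp (-f x) / Z * (ρ x * Real.log (ρ x)) = _
      rw [← mul_assoc, ← hgsq]
      by_cases h0 : g x = 0
      · simp [h0]
      · rw [hρg x, Real.log_mul (by positivity) (by positivity),
          Real.log_mul (by positivity) (by positivity), Real.log_exp]
        ring
    rw [h1, integral_add (by exact igl.add ifg) (ig.const_mul _), integral_add igl ifg,
      integral_const_mul, g1, mul_one]
  -- FI
  have hFI : FIdiv μ ρ = ∑ i, ((∫ x, 4 * (fderiv ℝ g x (e i)) ^ 2) +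
      2 * (∫ x, fderiv ℝ f x (e i) * (2 * g x * fderiv ℝ g x (e i))) +
      ∫ x, (fderiv ℝ f x (e i)) ^ 2 * g x ^ 2) := by
    have h1 : FIdiv μ ρ = ∫ x, ∑ i, (4 * (fderiv ℝ g x (e i)) ^ 2 +
        2 * (fderiv ℝ f x (e i) * (2 * g x * fderiv ℝ g x (e i))) +
        (fderiv ℝ f x (e i)) ^ 2 * g x ^ 2) := by
      rw [FIdiv, hintegral]
      refine integral_congr_ae (Filter.Eventually.of_forall fun x => ?_)
      show Real.exp (-f x) / Z * (‖gradient (fun y => Real.log (ρ y)) x‖ ^ 2 * ρ x) = _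
      rw [mul_left_comm, ← hgsq]
      by_cases h0 : g x = 0
      · have : fderiv ℝ g x = 0 := by
          apply IsLocalMin.fderiv_eq_zero
          exact Filter.Eventually.of_forall fun y => by rw [h0]; exact hg0 y
        simp [h0, this]
      · have hgx : 0 < g x := lt_of_le_of_ne (hg0 x) (Ne.symm h0)
        have hev : (fun y => Real.log (ρ y)) =ᶠ[nhds x]
            fun y => 2 * Real.log (g y) + f y + Real.log Z := by
          filter_upwards [hgc.continuousAt.eventually (lt_mem_nhds hgx)] with y hy
          rw [hρg y, Real.log_mul (by positivity) (by positivity),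
            Real.log_mul (by positivity) (by positivity), Real.log_exp, Real.log_pow]
          push_cast
          ring
        have hfd' : HasFDerivAt (fun y => Real.log (ρ y))
            ((2:ℝ) • ((g x)⁻¹ • fderiv ℝ g x) + fderiv ℝ f x) x := by
          refine HasFDerivAt.congr_of_eventuallyEq ?_ hev
          exact (((((hgd x).hasFDerivAt).log h0).const_mul 2).add (hfd x).hasFDerivAt).add_const _
        rw [norm_gradient_sq, hfd'.fderiv, Finset.sum_mul]
        refine Finset.sum_congr rfl fun i _ => ?_
        simp only [add_apply, smul_apply, smul_eq_mul, he]
        field_simp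
        ring
    rw [h1, integral_finsetSum _ fun i _ => by
      exact ((iA i).add ((iB i).const_mul 2)).add (iD i)]
    refine Finset.sum_congr rfl fun i _ => ?_
    rw [integral_add (by exact (iA i).add ((iB i).const_mul 2)) (iD i),
      integral_add (iA i) ((iB i).const_mul 2)]
    simp only [integral_const_mul]
  -- integration by parts
  have hgradC : ContDiff ℝ 1 (gradient f) := by
    have h1 : ContDiff ℝ 1 (fderiv ℝ f) := hf.fderiv_right (by norm_num)
    exact (InnerProductSpace.toDual ℝ (EuclideanSpace ℝ (Fin d))).symm.contDiff.comp h1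
  have hfi : ∀ i, (fun x => fderiv ℝ f x (e i)) = fun x => ⟪e i, gradient f x⟫ := by
    intro i; funext x
    rw [real_inner_comm]
    simp [gradient]
  have hgrd : Differentiable ℝ (gradient f) := hgradC.differentiable (by norm_num)
  have hffi : ∀ i x, fderiv ℝ (fun x => fderiv ℝ f x (e i)) x (e i) =
      ⟪e i, fderiv ℝ (gradient f) x (e i)⟫ := by
    intro i x
    rw [hfi i]
    have := ((innerSL ℝ (e i)).hasFDerivAt (x := gradient f x)).comp x (hgrd x).hasFDerivAt
    have h2 : HasFDerivAt (fun x => ⟪e i, gradient f x⟫)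
      ((innerSL ℝ (e i)).comp (fderiv ℝ (gradient f) x)) x := this
    rw [h2.fderiv]
    simp
  have hlapc : ∀ i, Continuous fun x => ⟪e i, fderiv ℝ (gradient f) x (e i)⟫ := fun i =>
    continuous_const.inner ((hgradC.continuous_fderiv (by norm_num)).clm_apply continuous_const)
  have iL : ∀ i, Integrable (fun x => ⟪e i, fderiv ℝ (gradient f) x (e i)⟫ * g x ^ 2) := fun i =>
    ((hlapc i).mul (hgc.pow 2)).integrable_of_hasCompactSupport hcs2.mul_left
  have hg2 : ∀ i x, fderiv ℝ (fun x => g x ^ 2) x (e i) = 2 * g x * fderiv ℝ g x (e i) := by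
    intro i x
    have := ((hgd x).hasFDerivAt.pow 2).fderiv
    rw [this]
    simp
  have ibp : ∀ i, ∫ x, fderiv ℝ f x (e i) * (2 * g x * fderiv ℝ g x (e i)) =
      - ∫ x, ⟪e i, fderiv ℝ (gradient f) x (e i)⟫ * g x ^ 2 := by
    intro i
    have := integral_mul_fderiv_eq_neg_fderiv_mul_of_integrable
      (μ := (volume : Measure (EuclideanSpace ℝ (Fin d))))
      (f := fun x => fderiv ℝ f x (e i)) (g := fun x => g x ^ 2) (v := e i)
      (by simp only [hffi]; exact iL i) (by simp only [hg2]; exact iB i)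
      (((hdf i).mul (hgc.pow 2)).integrable_of_hasCompactSupport hcs2.mul_left)
      (fun x _ => by
        rw [hfi i]
        exact (differentiableAt_const _).inner ℝ (hgrd x))
      (fun x _ => (hgd x).pow 2)
    simp only [hffi, hg2] at this
    exact this
  have hL : ∑ i, ∫ x, ⟪e i, fderiv ℝ (gradient f) x (e i)⟫ * g x ^ 2 ≤ L₀ := by
    rw [← integral_finsetSum _ fun i _ => iL i]
    calc _ ≤ ∫ x, L₀ * g x ^ 2 := by
          refine integral_mono (integrable_finsetSum _ fun i _ => iL i) (ig.const_mul _) fun x => ?_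
          show ∑ i, ⟪e i, fderiv ℝ (gradient f) x (e i)⟫ * g x ^ 2 ≤ L₀ * g x ^ 2
          rw [← Finset.sum_mul]
          exact mul_le_mul_of_nonneg_right (hlap x) (sq_nonneg _)
      _ = L₀ := by rw [integral_const_mul, g1, mul_one]
  have hP : ∫ x, f x * g x ^ 2 ≤ CPL / 2 * ∑ i, ∫ x, (fderiv ℝ f x (e i)) ^ 2 * g x ^ 2 := by
    rw [← integral_finsetSum _ fun i _ => iD i, ← integral_const_mul]
    refine integral_mono ifg ((integrable_finsetSum _ fun i _ => iD i).const_mul _) fun x => ?_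
    show f x * g x ^ 2 ≤ CPL / 2 * ∑ i, (fderiv ℝ f x (e i)) ^ 2 * g x ^ 2
    rw [← Finset.sum_mul, ← mul_assoc, ← norm_gradient_sq]
    exact mul_le_mul_of_nonneg_right (hPL x) (sq_nonneg _)
  rw [Finset.sum_add_distrib, Finset.sum_add_distrib, ← Finset.mul_sum,
    Finset.sum_congr rfl fun i _ => ibp i, Finset.sum_neg_distrib] at hFI
  have hL2 := mul_le_mul_of_nonneg_left hL hCPL.le
  rw [hKL, hFI]
  linarith
end
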